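/- arXiv:2207.05840 — 5 statements merged into one kernel-verified Lean document; each statement's English description precedes it below -/
import Mathlib

section
/- Let H be a 3-graph and let a > 1 and A > 0 be real numbers such that A·t^a < R(H, K_t) for all integers t ≥ 1. Then for every ε > 0 there exists r_0 such that for all integers r ≥ r_0 one has m_H(r) ≤ (1+ε) · (1/(6·A^{3/(a-1)})) · r^{3a/(a-1)}. -/
/-- A 3-graph: a finite vertex set `Fin n` together with a family of 3-element edges. -/
structure ThreeGraph where
  n : ℕ
  edges : Finset (Finset (Fin n))
  card_eq : ∀ e ∈ edges, e.card = 3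

namespace ThreeGraph

/-- `G` contains a (not necessarily induced) copy of `H`. -/
def ContainsCopy (G H : ThreeGraph) : Prop :=
  ∃ f : Fin H.n ↪ Fin G.n, ∀ e ∈ H.edges, e.image f ∈ G.edges

/-- `G` is `H`-free: it contains no subgraph isomorphic to `H`. -/
def Free (G H : ThreeGraph) : Prop := ¬ G.ContainsCopy H

/-- `G` admits a proper coloring with `r` colors: no edge is monochromatic. -/
def Colorable (G : ThreeGraph) (r : ℕ) : Prop :=
  ∃ c : Fin G.n → Fin r, ∀ e ∈ G.edges, ∃ u ∈ e, ∃ v ∈ e, c u ≠ c v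

/-- `S` is an independent set in `G`: it contains no edge of `G`. -/
def IndepSet (G : ThreeGraph) (S : Finset (Fin G.n)) : Prop :=
  ∀ e ∈ G.edges, ¬ e ⊆ S

/-- The degree of a vertex: the number of edges containing it. -/
def degree (G : ThreeGraph) (v : Fin G.n) : ℕ :=
  (G.edges.filter (fun e => v ∈ e)).card

end ThreeGraph

/-- Every 3-graph on `N` vertices contains a copy of `H` or an independent set of `t` vertices. -/
def RamseyProp (H : ThreeGraph) (t N : ℕ) : Prop :=
  ∀ G : ThreeGraph, G.n = N →
    G.ContainsCopy H ∨ ∃ S : Finset (Fin G.n), G.IndepSet S ∧ t ≤ S.card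

/-- The Ramsey number `R(H, K_t)`: the least `N` such that every 3-graph on `N` vertices
contains a copy of `H` or an independent set of `t` vertices. -/
noncomputable def ramsey (H : ThreeGraph) (t : ℕ) : ℕ :=
  sInf {N | RamseyProp H t N}

theorem Nat.six_mul_choose_succ_three_le (m : ℕ) : 6 * (m + 1).choose 3 ≤ m ^ 3 := by
  induction m with
  | zero => simp [Nat.choose]
  | succ m ih =>
    have h1 : (m + 1 + 1).choose 3 = (m + 1).choose 2 + (m + 1).choose 3 :=
      Nat.choose_succ_succ _ _
    have h2 : 2 * (m + 1).choose 2 ≤ (m + 1) * m := by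
      rw [Nat.choose_two_right, Nat.add_sub_cancel]
      exact Nat.mul_div_le _ _
    rw [h1]
    nlinarith

namespace ThreeGraph

theorem card_edges_le_choose (G : ThreeGraph) : G.edges.card ≤ G.n.choose 3 := by
  calc G.edges.card ≤ (Finset.powersetCard 3 (Finset.univ : Finset (Fin G.n))).card :=
        Finset.card_le_card fun e he =>
          Finset.mem_powersetCard.2 ⟨Finset.subset_univ e, G.card_eq e he⟩
    _ = G.n.choose 3 := by simp

/-- By pigeonhole, an `r`-colorable 3-graph with more than `r * s` vertices has an independent
set of more than `s` vertices. -/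
theorem Colorable.exists_indepSet {G : ThreeGraph} {r s : ℕ} (h : G.Colorable r)
    (hn : r * s < G.n) : ∃ S : Finset (Fin G.n), G.IndepSet S ∧ s < S.card := by
  obtain ⟨c, hc⟩ := h
  obtain ⟨y, hy⟩ := Fintype.exists_lt_card_fiber_of_mul_lt_card (f := c) (n := s) (by simpa using hn)
  refine ⟨_, fun e he hsub => ?_, hy⟩
  obtain ⟨u, hu, v, hv, huv⟩ := hc e he
  have h1 := hsub hu
  have h2 := hsub hv
  simp only [Finset.mem_filter, Finset.mem_univ, true_and] at h1 h2
  exact huv (h1.trans h2.symm)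

/-- If `r * s + 1` is below the Ramsey number `R(H, K_{s+1})`, there is an `H`-free 3-graph that
is not `r`-colorable and has at most `(r * s) ^ 3 / 6` edges. -/
theorem exists_free_not_colorable {H : ThreeGraph} {r s : ℕ}
    (h : r * s + 1 < ramsey H (s + 1)) :
    ∃ G : ThreeGraph, G.Free H ∧ ¬ G.Colorable r ∧ 6 * G.edges.card ≤ (r * s) ^ 3 := by
  have hN : ¬ RamseyProp H (s + 1) (r * s + 1) := Nat.notMem_of_lt_sInf h
  unfold RamseyProp at hN
  push Not at hN
  obtain ⟨G, hG, hfree, hind⟩ := hN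
  refine ⟨G, hfree, fun hcol => ?_, ?_⟩
  · obtain ⟨S, hS, hcard⟩ := hcol.exists_indepSet (s := s) (by omega)
    have := hind S hS
    omega
  · calc 6 * G.edges.card ≤ 6 * G.n.choose 3 := by
          gcongr
          exact G.card_edges_le_choose
      _ ≤ (r * s) ^ 3 := by
          rw [hG]
          exact Nat.six_mul_choose_succ_three_le _

end ThreeGraph

/-- If `A·t^a < R(H, K_t)` for all `t ≥ 1` (with `a > 1`, `A > 0`), then for
every `ε > 0` and all sufficiently large `r`,
`m_H(r) ≤ (1+ε) · (1/(6·A^(3/(a-1)))) · r^(3a/(a-1))`; that is, there is an `H`-free 3-graph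
with chromatic number `> r` and at most that many edges. -/
theorem mH_upper_of_ramsey_poly_lower
    (H : ThreeGraph) (a A : ℝ) (ha : 1 < a) (hA : 0 < A)
    (hR : ∀ t : ℕ, 1 ≤ t → A * (t : ℝ) ^ a < (ramsey H t : ℝ)) :
    ∀ ε : ℝ, 0 < ε → ∃ r₀ : ℕ, ∀ r : ℕ, r₀ ≤ r →
      ∃ G : ThreeGraph, G.Free H ∧ ¬ G.Colorable r ∧
        (G.edges.card : ℝ) ≤
          (1 + ε) * (1 / (6 * A ^ ((3 : ℝ) / (a - 1)))) * (r : ℝ) ^ (3 * a / (a - 1)) := by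
  intro ε hε
  refine ⟨1, fun r hr => ?_⟩
  have ha' : 0 < a - 1 := by linarith
  have hr0 : (0 : ℝ) < r := by exact_mod_cast hr
  set x : ℝ := (r / A) ^ (1 / (a - 1)) with hx
  have hx0 : 0 < x := by positivity
  obtain ⟨s, hs⟩ : ∃ s, ⌈x⌉₊ = s + 1 := Nat.exists_eq_add_one.2 (Nat.ceil_pos.2 hx0)
  have hsx : (s : ℝ) ≤ x := (Nat.lt_ceil.1 (by omega)).le
  have hxs : x ≤ ((s + 1 : ℕ) : ℝ) := hs ▸ Nat.le_ceil x
  have hxpow : x ^ (a - 1) = r / A := by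
    rw [hx, ← Real.rpow_mul (by positivity), one_div_mul_cancel ha'.ne', Real.rpow_one]
  have hlt : r * s + 1 < ramsey H (s + 1) := by
    have hs0 : (0 : ℝ) < ((s + 1 : ℕ) : ℝ) := by positivity
    have h1 : (r : ℝ) ≤ A * ((s + 1 : ℕ) : ℝ) ^ (a - 1) := by
      have := hxpow ▸ Real.rpow_le_rpow hx0.le hxs ha'.le
      rwa [div_le_iff₀' hA] at this
    have h2 : (r : ℝ) * ((s + 1 : ℕ) : ℝ) < ramsey H (s + 1) := by
      calc (r : ℝ) * ((s + 1 : ℕ) : ℝ)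
          ≤ A * ((s + 1 : ℕ) : ℝ) ^ (a - 1) * ((s + 1 : ℕ) : ℝ) := by gcongr
        _ = A * ((s + 1 : ℕ) : ℝ) ^ a := by
            rw [Real.rpow_sub_one hs0.ne']
            field_simp
        _ < ramsey H (s + 1) := hR (s + 1) (by omega)
    have h3 : r * (s + 1) < ramsey H (s + 1) := by exact_mod_cast h2
    nlinarith
  obtain ⟨G, hfree, hcol, hcard⟩ := ThreeGraph.exists_free_not_colorable hlt
  refine ⟨G, hfree, hcol, ?_⟩
  have hcard' : 6 * (G.edges.card : ℝ) ≤ (r * s) ^ 3 := by exact_mod_cast hcard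
  have hx3 : x ^ 3 = (r : ℝ) ^ (3 / (a - 1)) / A ^ (3 / (a - 1)) := by
    rw [hx, ← Real.rpow_natCast, ← Real.rpow_mul (by positivity),
      ← Real.div_rpow hr0.le hA.le]
    congr 1
    push_cast
    ring
  have hexp : (r : ℝ) ^ (3 * a / (a - 1)) = r ^ 3 * (r : ℝ) ^ (3 / (a - 1)) := by
    rw [← Real.rpow_natCast, ← Real.rpow_add hr0]
    congr 1
    field_simp
    push_cast
    ring
  calc (G.edges.card : ℝ) ≤ (r * s) ^ 3 / 6 := by linarith
    _ ≤ (r * x) ^ 3 / 6 := by gcongr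
    _ = 1 * (1 / (6 * A ^ ((3 : ℝ) / (a - 1)))) * (r : ℝ) ^ (3 * a / (a - 1)) := by
        rw [mul_pow, hx3, hexp]
        field_simp
    _ ≤ (1 + ε) * (1 / (6 * A ^ ((3 : ℝ) / (a - 1)))) * (r : ℝ) ^ (3 * a / (a - 1)) := by
        gcongr
        linarith
end

section
/- Let H be a 3-graph and let b > 1 and B > 0 be real numbers such that R(H, K_t) ≤ B·t^b for all integers t ≥ 1. Set B' = ((1 − 2^{1−b}) / (2^{b/(b−1)+b+3} · (12e)^{b−1} · B · (b/(b−1)+2)^b))^{1/(b−1)}. Then for all integers r ≥ 1 one has m_H(r) ≥ B' · r^{b/(b−1)+2}. -/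
open Finset

/-- Finite Ramsey theorem for `k`-uniform hypergraphs and two colors. -/
theorem exists_ramsey_bound (k a b : ℕ) : ∃ N : ℕ, ∀ (α : Type) [DecidableEq α] (S : Finset α),
    N ≤ S.card → ∀ E : Finset α → Prop,
      (∃ A ⊆ S, a ≤ A.card ∧ ∀ e ⊆ A, e.card = k → E e) ∨
      (∃ A ⊆ S, b ≤ A.card ∧ ∀ e ⊆ A, e.card = k → ¬ E e) := by
  induction k generalizing a b with
  | zero =>
    refine ⟨max a b, fun α _ S hS E => ?_⟩
    by_cases h : E ∅
    · refine Or.inl ⟨S, Subset.rfl, le_trans (le_max_left _ _) hS, fun e _ he => ?_⟩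
      rwa [card_eq_zero.1 he]
    · refine Or.inr ⟨S, Subset.rfl, le_trans (le_max_right _ _) hS, fun e _ he => ?_⟩
      rwa [card_eq_zero.1 he]
  | succ k ihk =>
    induction a generalizing b with
    | zero =>
      refine ⟨0, fun α _ S hS E => Or.inl ⟨∅, empty_subset _, le_rfl, fun e he hc => ?_⟩⟩
      rw [subset_empty.1 he] at hc
      simp at hc
    | succ a iha =>
      induction b with
      | zero =>
        refine ⟨0, fun α _ S hS E => Or.inr ⟨∅, empty_subset _, le_rfl, fun e he hc => ?_⟩⟩
        rw [subset_empty.1 he] at hc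
        simp at hc
      | succ b ihb =>
        obtain ⟨N₁, h₁⟩ := iha (b + 1)
        obtain ⟨N₂, h₂⟩ := ihb
        obtain ⟨N, hN⟩ := ihk N₁ N₂
        refine ⟨N + 1, fun α _ S hS E => ?_⟩
        obtain ⟨v, hv⟩ : S.Nonempty := card_pos.1 (by omega)
        have key : ∀ (F : Finset α → Prop) (A A' : Finset α) (m : ℕ), A ⊆ S.erase v → A' ⊆ A →
            m ≤ A'.card → (∀ e ⊆ A, e.card = k → F (insert v e)) →
            (∀ e ⊆ A', e.card = k + 1 → F e) →
            ∃ C ⊆ S, m + 1 ≤ C.card ∧ ∀ e ⊆ C, e.card = k + 1 → F e := by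
          intro F A A' m hA hA' hm hF hF'
          have hvA : v ∉ A := fun h => notMem_erase v S (hA h)
          refine ⟨insert v A', insert_subset hv
            ((hA'.trans hA).trans (erase_subset _ _)), ?_, fun e he hc => ?_⟩
          · rw [card_insert_of_notMem (fun h => hvA (hA' h))]
            omega
          · by_cases hve : v ∈ e
            · rw [← insert_erase hve]
              refine hF _ ((subset_insert_iff.1 he).trans hA') ?_
              rw [card_erase_of_mem hve]
              omega
            · exact hF' e ((subset_insert_iff_of_notMem hve).1 he) hc
        have hsub : S.erase v ⊆ S := erase_subset _ _
        obtain ⟨A, hA, hcA, hE⟩ | ⟨A, hA, hcA, hE⟩ :=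
          hN α (S.erase v) (by rw [card_erase_of_mem hv]; omega) (fun e => E (insert v e))
        · obtain ⟨A', hA', hc', hE'⟩ | ⟨A', hA', hc', hE'⟩ := h₁ α A hcA E
          · exact Or.inl (key E A A' a hA hA' hc' hE hE')
          · exact Or.inr ⟨A', (hA'.trans hA).trans hsub, hc', hE'⟩
        · obtain ⟨A', hA', hc', hE'⟩ | ⟨A', hA', hc', hE'⟩ := h₂ α A hcA E
          · exact Or.inl ⟨A', (hA'.trans hA).trans hsub, hc', hE'⟩
          · exact Or.inr (key (fun e => ¬ E e) A A' b hA hA' hc' hE hE')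

theorem ramseyProp_ramsey (H : ThreeGraph) (t : ℕ) : RamseyProp H t (ramsey H t) := by
  refine Nat.sInf_mem (s := {N | RamseyProp H t N}) ?_
  obtain ⟨N, hN⟩ := exists_ramsey_bound 3 H.n t
  refine ⟨N, fun G hG => ?_⟩
  obtain ⟨A, -, hcA, hE⟩ | ⟨A, -, hcA, hE⟩ :=
    hN (Fin G.n) univ (by simp [hG]) (fun e => e ∈ G.edges)
  · left
    obtain ⟨A', hA', hc⟩ := exists_subset_card_eq hcA
    refine ⟨(A'.orderEmbOfFin hc).toEmbedding, fun e he => hE _ ?_ ?_⟩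
    · intro x hx
      obtain ⟨y, -, rfl⟩ := mem_image.1 hx
      exact hA' (A'.orderEmbOfFin_mem hc y)
    · rw [card_image_of_injective _ (Function.Embedding.injective _), H.card_eq e he]
  · exact Or.inr ⟨A, fun e he hs => hE e hs (G.card_eq e he) he, hcA⟩

namespace ThreeGraph

variable {G H : ThreeGraph}

theorem Free.n_pos (hG : G.Free H) : 0 < H.n := by
  by_contra h
  have h0 : H.n = 0 := by omega
  have : IsEmpty (Fin H.n) := by rw [h0]; infer_instance
  refine hG ⟨⟨isEmptyElim, fun x => isEmptyElim x⟩, fun e he => ?_⟩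
  have := H.card_eq e he
  rw [eq_empty_of_isEmpty e] at this
  simp at this

theorem Free.one_le_ramsey (hG : G.Free H) : 1 ≤ ramsey H 1 := by
  by_contra h
  have h0 : ramsey H 1 = 0 := by omega
  have hP := ramseyProp_ramsey H 1
  rw [h0] at hP
  obtain ⟨f, -⟩ | ⟨S, -, hS⟩ := hP ⟨0, ∅, by simp⟩ rfl
  · exact (f ⟨0, hG.n_pos⟩).elim0
  · have : S.card ≤ 0 := S.card_le_univ.trans (le_of_eq (Fintype.card_fin 0))
    omega

/-- An `H`-free 3-graph has large independent sets inside every large vertex set. -/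
theorem Free.exists_indepSet (hG : G.Free H) {U : Finset (Fin G.n)} {t : ℕ}
    (hU : ramsey H t ≤ U.card) : ∃ I ⊆ U, G.IndepSet I ∧ t ≤ I.card := by
  obtain ⟨U', hU', hc⟩ := exists_subset_card_eq hU
  let f := (U'.orderEmbOfFin hc).toEmbedding
  let G' : ThreeGraph :=
    ⟨ramsey H t, univ.filter (fun e => e.card = 3 ∧ e.map f ∈ G.edges),
      fun e he => (mem_filter.1 he).2.1⟩
  obtain ⟨g, hg⟩ | ⟨S, hS, hSc⟩ := ramseyProp_ramsey H t G' rfl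
  · refine (hG ⟨g.trans f, fun e he => ?_⟩).elim
    have := (mem_filter.1 (hg e he)).2.2
    rw [map_eq_image, image_image] at this
    exact this
  · refine ⟨S.map f, ?_, ?_, by rwa [card_map]⟩
    · intro x hx
      obtain ⟨y, -, rfl⟩ := mem_map.1 hx
      exact hU' (U'.orderEmbOfFin_mem hc y)
    · intro e he hes
      obtain ⟨e', he', rfl⟩ := subset_map_iff.1 hes
      refine hS e' (mem_filter.2 ⟨mem_univ _, ?_, he⟩) he'
      have := G.card_eq _ he
      rwa [card_map] at this

/-- The coloring `c` leaves no edge inside `U` monochromatic. -/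
def ProperOn {κ : Type} (G : ThreeGraph) (U : Finset (Fin G.n)) (c : Fin G.n → κ) : Prop :=
  ∀ e ∈ G.edges, e ⊆ U → ∃ u ∈ e, ∃ v ∈ e, c u ≠ c v

/-- The sub-3-graph of `G` induced on `U` is properly colorable with `k` colors. -/
def ColorableOn (G : ThreeGraph) (U : Finset (Fin G.n)) (k : ℕ) : Prop :=
  ∃ c : Fin G.n → ℕ, (∀ v ∈ U, c v < k) ∧ G.ProperOn U c

theorem ColorableOn.union {U W : Finset (Fin G.n)} {k s : ℕ}
    (hU : G.ColorableOn U k) (hW : G.ColorableOn W s) : G.ColorableOn (U ∪ W) (k + s) := by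
  obtain ⟨c, hc, hcp⟩ := hU
  obtain ⟨d, hd, hdp⟩ := hW
  refine ⟨fun v => if v ∈ U then c v else k + d v, fun v hv => ?_, fun e he hes => ?_⟩
  · by_cases h : v ∈ U
    · have := hc v h
      simp only [h, if_true]
      omega
    · have := hd v ((mem_union.1 hv).resolve_left h)
      simp only [h, if_false]
      omega
  · by_cases h₁ : e ⊆ U
    · obtain ⟨u, hu, v, hv, huv⟩ := hcp e he h₁
      exact ⟨u, hu, v, hv, by simpa [h₁ hu, h₁ hv] using huv⟩
    obtain ⟨w, hw, hwU⟩ := not_subset.1 h₁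
    by_cases h₂ : ∃ u ∈ e, u ∈ U
    · obtain ⟨u, hu, huU⟩ := h₂
      refine ⟨u, hu, w, hw, ?_⟩
      have := hc u huU
      simp only [huU, hwU, if_true, if_false]
      omega
    · push Not at h₂
      obtain ⟨u, hu, v, hv, huv⟩ := hdp e he
        (fun x hx => (mem_union.1 (hes hx)).resolve_left (h₂ x hx))
      exact ⟨u, hu, v, hv, by simpa [h₂ u hu, h₂ v hv] using huv⟩

theorem ColorableOn.colorable {r : ℕ} (h : G.ColorableOn univ r) : G.Colorable r := by
  obtain ⟨c, hc, hcp⟩ := h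
  refine ⟨fun v => ⟨c v, hc v (mem_univ v)⟩, fun e he => ?_⟩
  obtain ⟨u, hu, v, hv, huv⟩ := hcp e he (subset_univ e)
  exact ⟨u, hu, v, hv, by simpa using huv⟩

theorem IndepSet.colorableOn {I : Finset (Fin G.n)} (h : G.IndepSet I) : G.ColorableOn I 1 :=
  ⟨fun _ => 0, by simp, fun e he hes => (h e he hes).elim⟩

open Classical in
/-- The number of colorings of all vertices with `s` colors that are proper on `U`. -/
noncomputable def numProper (G : ThreeGraph) (s : ℕ) (U : Finset (Fin G.n)) : ℕ :=
  (univ.filter (fun c : Fin G.n → Fin s => G.ProperOn U c)).card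

open Classical in
theorem card_monochromatic_mul_sq_le {s : ℕ} {W : Finset (Fin G.n)} {u v w : Fin G.n}
    (hu : u ∉ W) (hv : v ∉ W) (huv : u ≠ v) (huw : u ≠ w) (hvw : v ≠ w) :
    (univ.filter (fun c : Fin G.n → Fin s => G.ProperOn W c ∧ c u = c w ∧ c v = c w)).card
      * s ^ 2 ≤ G.numProper s W := by
  set T := univ.filter (fun c : Fin G.n → Fin s => G.ProperOn W c ∧ c u = c w ∧ c v = c w)
  have hcard : (T ×ˢ (univ : Finset (Fin s × Fin s))).card = T.card * s ^ 2 := by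
    simp [card_product, sq]
  rw [← hcard]
  refine card_le_card_of_injOn
    (fun x => Function.update (Function.update x.1 u x.2.1) v x.2.2) ?_ ?_
  · rintro ⟨c, i, j⟩ hx
    have hc := (mem_filter.1 (mem_product.1 hx).1).2.1
    refine mem_filter.2 ⟨mem_univ _, fun e he hes => ?_⟩
    obtain ⟨x, hx, y, hy, hxy⟩ := hc e he hes
    have hne : ∀ z ∈ e, z ≠ u ∧ z ≠ v := fun z hz =>
      ⟨fun h => hu (h ▸ hes hz), fun h => hv (h ▸ hes hz)⟩
    refine ⟨x, hx, y, hy, ?_⟩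
    simpa [Function.update_of_ne, hne x hx, hne y hy] using hxy
  · rintro ⟨c, i, j⟩ hx ⟨c', i', j'⟩ hx' h
    have hc := (mem_filter.1 (mem_product.1 hx).1).2.2
    have hc' := (mem_filter.1 (mem_product.1 hx').1).2.2
    simp only at hc hc' h
    have hz : ∀ z, z ≠ u → z ≠ v → c z = c' z := fun z h₁ h₂ => by
      simpa [Function.update_of_ne, h₁, h₂] using congrFun h z
    have hw := hz w huw.symm hvw.symm
    have hi : i = i' := by simpa [Function.update_of_ne, huv] using congrFun h u
    have hj : j = j' := by simpa using congrFun h v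
    have hcc : c = c' := by
      funext z
      by_cases h₁ : z = u
      · rw [h₁, hc.1, hc'.1, hw]
      by_cases h₂ : z = v
      · rw [h₂, hc.2, hc'.2, hw]
      exact hz z h₁ h₂
    rw [hcc, hi, hj]

open Classical in
/-- Counting argument of Rosenfeld: adding a vertex of low degree to the properly colored set
at most halves the number of colorings. -/
theorem numProper_le_two_mul {s : ℕ} (hs : 0 < s) {L : Finset (Fin G.n)}
    (hL : ∀ v ∈ L, 4 * G.degree v ≤ s ^ 2) (U : Finset (Fin G.n)) :
    U ⊆ L → ∀ v ∈ L, v ∉ U → G.numProper s U ≤ 2 * G.numProper s (insert v U) := by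
  induction U using Finset.strongInduction with
  | H U ih =>
    intro hUL v hv hvU
    set E := G.edges.filter (fun e => v ∈ e) with hE
    set bad : Finset (Fin G.n) → Finset (Fin G.n → Fin s) := fun e =>
      univ.filter (fun c => G.ProperOn U c ∧ e ⊆ insert v U ∧ ∀ x ∈ e, ∀ y ∈ e, c x = c y)
      with hbad
    have hcover : univ.filter (fun c : Fin G.n → Fin s => G.ProperOn U c) ⊆
        univ.filter (fun c : Fin G.n → Fin s => G.ProperOn (insert v U) c) ∪ E.biUnion bad := by
      intro c hc
      have hcU := (mem_filter.1 hc).2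
      by_cases h : G.ProperOn (insert v U) c
      · exact mem_union_left _ (mem_filter.2 ⟨mem_univ _, h⟩)
      · refine mem_union_right _ (mem_biUnion.2 ?_)
        unfold ProperOn at h
        push Not at h
        obtain ⟨e, he, hes, hm⟩ := h
        have hve : v ∈ e := by
          by_contra hve
          obtain ⟨x, hx, y, hy, hxy⟩ := hcU e he ((subset_insert_iff_of_notMem hve).1 hes)
          exact hxy (hm x hx y hy)
        exact ⟨e, mem_filter.2 ⟨he, hve⟩, mem_filter.2 ⟨mem_univ _, hcU, hes, hm⟩⟩
    have hbadle : ∀ e ∈ E, (bad e).card * s ^ 2 ≤ 2 * G.numProper s U := by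
      intro e he
      obtain ⟨heG, hve⟩ := mem_filter.1 he
      by_cases hes : e ⊆ insert v U
      swap
      · simp [hbad, hes]
      have h2 : (e.erase v).card = 2 := by rw [card_erase_of_mem hve, G.card_eq e heG]
      obtain ⟨u, w, huw, huwe⟩ := card_eq_two.1 h2
      have hu : u ∈ e.erase v := by simp [huwe]
      have hw : w ∈ e.erase v := by simp [huwe]
      have huU : u ∈ U := (subset_insert_iff.1 hes) hu
      have hIH := ih (U.erase u) (erase_ssubset huU) ((erase_subset _ _).trans hUL) u (hUL huU)
        (notMem_erase u U)
      rw [insert_erase huU] at hIH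
      refine le_trans (le_trans (Nat.mul_le_mul_right _ (card_le_card ?_))
        (card_monochromatic_mul_sq_le (s := s) (W := U.erase u) (u := u) (v := v) (w := w)
          (notMem_erase u U) (fun h => hvU (mem_of_mem_erase h)) (ne_of_mem_erase hu) huw
          (ne_of_mem_erase hw).symm)) hIH
      intro c hc
      obtain ⟨-, hcU, -, hm⟩ := mem_filter.1 hc
      refine mem_filter.2 ⟨mem_univ _, fun e' he' hes' => hcU e' he'
        (hes'.trans (erase_subset _ _)), ?_, ?_⟩
      · exact hm _ (mem_of_mem_erase hu) _ (mem_of_mem_erase hw)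
      · exact hm _ hve _ (mem_of_mem_erase hw)
    have hsum : (E.biUnion bad).card * s ^ 2 ≤ E.card * (2 * G.numProper s U) := by
      refine le_trans (Nat.mul_le_mul_right _ card_biUnion_le) ?_
      rw [sum_mul, ← smul_eq_mul E.card]
      exact sum_le_card_nsmul _ _ _ hbadle
    have hle : G.numProper s U ≤ G.numProper s (insert v U) + (E.biUnion bad).card :=
      (card_le_card hcover).trans (card_union_le _ _)
    have hdeg : 4 * E.card ≤ s ^ 2 := hL v hv
    have hs2 : 0 < s ^ 2 := by positivity
    have hhalf : 2 * (E.biUnion bad).card ≤ G.numProper s U := by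
      refine Nat.le_of_mul_le_mul_right ?_ hs2
      nlinarith [Nat.mul_le_mul_right (G.numProper s U) hdeg]
    omega

/-- A set of vertices of degree at most `s ^ 2 / 4` is colorable with `s` colors. -/
theorem colorableOn_of_degree_le {s : ℕ} (hs : 0 < s) {L : Finset (Fin G.n)}
    (hL : ∀ v ∈ L, 4 * G.degree v ≤ s ^ 2) : G.ColorableOn L s := by
  classical
  have hpos : ∀ U : Finset (Fin G.n), U ⊆ L → 0 < G.numProper s U := by
    intro U
    induction U using Finset.induction_on with
    | empty =>
      intro _
      refine card_pos.2 ⟨fun _ => ⟨0, hs⟩, mem_filter.2 ⟨mem_univ _, fun e he hes => ?_⟩⟩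
      have := G.card_eq e he
      rw [subset_empty.1 hes] at this
      simp at this
    | insert v U hvU ih =>
      intro h
      have h₁ := ih ((subset_insert _ _).trans h)
      have h₂ := numProper_le_two_mul hs hL U ((subset_insert _ _).trans h) v
        (h (mem_insert_self _ _)) hvU
      omega
  obtain ⟨c, hc⟩ := card_pos.1 (hpos L Subset.rfl)
  refine ⟨fun v => c v, fun v _ => (c v).2, fun e he hes => ?_⟩
  obtain ⟨u, hu, v, hv, huv⟩ := (mem_filter.1 hc).2 e he hes
  exact ⟨u, hu, v, hv, fun h => huv (Fin.ext h)⟩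

theorem sum_degree (G : ThreeGraph) : ∑ v, G.degree v = 3 * G.edges.card := by
  unfold degree
  simp_rw [card_filter]
  rw [sum_comm]
  have : ∀ e ∈ G.edges, (∑ v : Fin G.n, if v ∈ e then 1 else 0) = 3 := fun e he => by
    rw [← card_filter, filter_mem_eq_inter, univ_inter, G.card_eq e he]
  rw [sum_congr rfl this, sum_const, smul_eq_mul, mul_comm]

/-- Greedy extraction of independent sets. -/
theorem Free.colorableOn {b B : ℝ} (hb : 1 < b) (hB : 0 < B)
    (hR : ∀ t : ℕ, 1 ≤ t → (ramsey H t : ℝ) ≤ B * (t : ℝ) ^ b) (hG : G.Free H)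
    (U : Finset (Fin G.n)) :
    ∀ k : ℕ, 2 * (b / (b - 1)) * B ^ (1 / b) * (U.card : ℝ) ^ (1 - 1 / b) ≤ k →
      G.ColorableOn U k := by
  induction U using Finset.strongInduction with
  | H U ih =>
    intro k hk
    obtain rfl | hne := U.eq_empty_or_nonempty
    · refine ⟨fun _ => 0, by simp, fun e he hes => ?_⟩
      have := G.card_eq e he
      rw [subset_empty.1 hes] at this
      simp at this
    have hb0 : 0 < b := by linarith
    have hn : 0 < (U.card : ℝ) := by exact_mod_cast card_pos.2 hne
    obtain ⟨I, hIU, hI, hIpos, hIc⟩ : ∃ I ⊆ U, G.IndepSet I ∧ 0 < I.card ∧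
        ((U.card : ℝ) / B) ^ (1 / b) ≤ 2 * I.card := by
      by_cases hx : 1 ≤ ((U.card : ℝ) / B) ^ (1 / b)
      · set x := ((U.card : ℝ) / B) ^ (1 / b) with hxdef
        have hfl : 1 ≤ ⌊x⌋₊ := (Nat.one_le_floor_iff x).2 hx
        have hfx : (⌊x⌋₊ : ℝ) ≤ x := Nat.floor_le (by linarith)
        have hxb : x ^ b = U.card / B := by
          rw [hxdef, ← Real.rpow_mul (by positivity), one_div_mul_cancel hb0.ne', Real.rpow_one]
        have hram : (ramsey H ⌊x⌋₊ : ℝ) ≤ U.card := by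
          refine (hR _ hfl).trans ?_
          calc B * (⌊x⌋₊ : ℝ) ^ b ≤ B * x ^ b := by gcongr
            _ = U.card := by rw [hxb]; field_simp
        obtain ⟨I, hIU, hI, hIc⟩ := hG.exists_indepSet (U := U) (by exact_mod_cast hram)
        refine ⟨I, hIU, hI, by omega, ?_⟩
        have h₁ : (⌊x⌋₊ : ℝ) ≤ I.card := by exact_mod_cast hIc
        have h₂ : (1 : ℝ) ≤ ⌊x⌋₊ := by exact_mod_cast hfl
        have h₃ := Nat.lt_floor_add_one x
        linarith
      · obtain ⟨v, hv⟩ := hne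
        refine ⟨{v}, singleton_subset_iff.2 hv, fun e he hes => ?_, by simp, ?_⟩
        · have h₁ := G.card_eq e he
          have h₂ := card_le_card hes
          rw [card_singleton] at h₂
          omega
        · push_cast [card_singleton]
          linarith
    have hIn : (I.card : ℝ) ≤ U.card := by exact_mod_cast card_le_card hIU
    have hsd : ((U \ I).card : ℝ) = U.card - I.card := by
      rw [card_sdiff_of_subset hIU, Nat.cast_sub (card_le_card hIU)]
    have ha0 : 0 ≤ 1 - 1 / b := by
      rw [sub_nonneg, div_le_one hb0]
      exact hb.le
    have ha1 : 1 - 1 / b ≤ 1 := by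
      have : 0 < 1 / b := by positivity
      linarith
    have hb1 : 0 < b - 1 := by linarith
    have hbern : ((U \ I).card : ℝ) ^ (1 - 1 / b) ≤
        (U.card : ℝ) ^ (1 - 1 / b) * (1 - (1 - 1 / b) * (I.card / U.card)) := by
      have h₁ : ((U \ I).card : ℝ) = U.card * (1 + -(I.card / U.card : ℝ)) := by
        rw [hsd]
        field_simp
        ring
      have h₂ : (-1 : ℝ) ≤ -(I.card / U.card : ℝ) := by
        rw [neg_le_neg_iff, div_le_one hn]
        exact hIn
      rw [h₁, Real.mul_rpow hn.le (by linarith)]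
      refine mul_le_mul_of_nonneg_left ?_ (by positivity)
      refine (rpow_one_add_le_one_add_mul_self h₂ ha0 ha1).trans (le_of_eq (by ring))
    have hstep : 2 * (b / (b - 1)) * B ^ (1 / b) * ((U.card : ℝ) ^ (1 - 1 / b) *
        ((1 - 1 / b) * (I.card / U.card))) = 2 * I.card / ((U.card : ℝ) / B) ^ (1 / b) := by
      rw [Real.div_rpow hn.le hB.le, Real.rpow_sub hn, Real.rpow_one]
      have h₁ : (U.card : ℝ) ^ (1 / b) ≠ 0 := by positivity
      have h₂ : B ^ (1 / b) ≠ 0 := by positivity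
      field_simp
    have hone : 1 ≤ 2 * (I.card : ℝ) / ((U.card : ℝ) / B) ^ (1 / b) := by
      rw [one_le_div (by positivity)]
      exact hIc
    have hcoef : 0 ≤ 2 * (b / (b - 1)) * B ^ (1 / b) := by positivity
    have hdec : 2 * (b / (b - 1)) * B ^ (1 / b) * ((U \ I).card : ℝ) ^ (1 - 1 / b) ≤ k - 1 := by
      have := mul_le_mul_of_nonneg_left hbern hcoef
      linarith
    have hk1 : 1 ≤ k := by
      have h₀ : 0 ≤ 2 * (b / (b - 1)) * B ^ (1 / b) * ((U \ I).card : ℝ) ^ (1 - 1 / b) := by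
        positivity
      have : (1 : ℝ) ≤ k := by linarith
      exact_mod_cast this
    have hrec := ih (U \ I) (sdiff_ssubset hIU (card_pos.1 hIpos)) (k - 1)
      (by rwa [Nat.cast_sub hk1, Nat.cast_one])
    have := hrec.union hI.colorableOn
    rwa [sdiff_union_of_subset hIU, Nat.sub_add_cancel hk1] at this

/-- Vertices of high degree are colored greedily with `k` colors and the others with `s`. -/
theorem Free.le_card_edges_of_not_colorable {b B : ℝ} (hb : 1 < b) (hB : 0 < B)
    (hR : ∀ t : ℕ, 1 ≤ t → (ramsey H t : ℝ) ≤ B * (t : ℝ) ^ b) (hG : G.Free H)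
    {k s : ℕ} (hs : 0 < s) (hc : ¬ G.Colorable (k + s)) :
    (s : ℝ) ^ 2 * ((k : ℝ) ^ (b / (b - 1)) /
      ((2 * (b / (b - 1))) ^ (b / (b - 1)) * B ^ (1 / (b - 1)))) ≤ 12 * G.edges.card := by
  classical
  set U := univ.filter (fun v => s ^ 2 < 4 * G.degree v) with hU
  have hb1 : 0 < b - 1 := by linarith
  have hb0 : 0 < b := by linarith
  have hlow : G.ColorableOn Uᶜ s := colorableOn_of_degree_le hs fun v hv => by
    simpa [hU] using hv
  have hk : (k : ℝ) < 2 * (b / (b - 1)) * B ^ (1 / b) * (U.card : ℝ) ^ (1 - 1 / b) := by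
    by_contra h
    have := (hG.colorableOn hb hB hR U k (not_lt.1 h)).union hlow
    rw [union_compl] at this
    exact hc this.colorable
  have hcard : U.card * s ^ 2 ≤ 12 * G.edges.card := by
    calc U.card * s ^ 2 ≤ ∑ v ∈ U, 4 * G.degree v := by
          rw [← smul_eq_mul]
          exact card_nsmul_le_sum _ _ _ fun v hv => (mem_filter.1 hv).2.le
      _ ≤ ∑ v, 4 * G.degree v := sum_le_sum_of_subset (subset_univ U)
      _ = 12 * G.edges.card := by
          rw [← mul_sum, sum_degree]
          ring
  have hcard' : (U.card : ℝ) * (s : ℝ) ^ 2 ≤ 12 * G.edges.card := by exact_mod_cast hcard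
  refine le_trans ?_ hcard'
  rw [mul_comm]
  refine mul_le_mul_of_nonneg_right ?_ (by positivity)
  rw [div_le_iff₀ (by positivity)]
  have hpow := Real.rpow_le_rpow (Nat.cast_nonneg k) hk.le
    (show 0 ≤ b / (b - 1) by positivity)
  refine hpow.trans (le_of_eq ?_)
  rw [Real.mul_rpow (by positivity) (by positivity), Real.mul_rpow (by positivity) (by positivity),
    ← Real.rpow_mul hB.le, ← Real.rpow_mul (Nat.cast_nonneg _)]
  have e₁ : 1 / b * (b / (b - 1)) = 1 / (b - 1) := by field_simp
  have e₂ : (1 - 1 / b) * (b / (b - 1)) = 1 := by field_simp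
  rw [e₁, e₂, Real.rpow_one]
  ring

end ThreeGraph

theorem rpow_constant_le {b B : ℝ} (hb : 1 < b) (hB : 0 < B) :
    ((1 - (2 : ℝ) ^ (1 - b)) /
            ((2 : ℝ) ^ (b / (b - 1) + b + 3) * (12 * Real.exp 1) ^ (b - 1) * B *
              (b / (b - 1) + 2) ^ b)) ^ ((1 : ℝ) / (b - 1)) ≤
      1 / ((2 : ℝ) ^ (5 * (b / (b - 1)) - 4) * (12 * Real.exp 1) * B ^ (1 / (b - 1)) *
        (b / (b - 1) + 2) ^ (b / (b - 1))) := by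
  have hb1 : 0 < b - 1 := by linarith
  have hb0 : 0 < b := by linarith
  have h2 : (2 : ℝ) ^ (1 - b) ≤ 1 :=
    Real.rpow_le_one_of_one_le_of_nonpos (by norm_num) (by linarith)
  have h2' : 0 < (2 : ℝ) ^ (1 - b) := by positivity
  have he := Real.exp_pos 1
  set p := b / (b - 1) with hp
  have hp0 : 0 < p := by positivity
  have hpq : 1 / (b - 1) = p - 1 := by
    rw [hp]
    field_simp
    ring
  have hbp : b * (p - 1) = p := by
    rw [hp]
    field_simp
    ring
  have hbp' : (b - 1) * (p - 1) = 1 := by linarith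
  have hp1 : 0 < p - 1 := by
    rw [← hpq]
    positivity
  rw [hpq]
  calc _ ≤ (1 / ((2 : ℝ) ^ (p + b + 3) * (12 * Real.exp 1) ^ (b - 1) * B *
              (p + 2) ^ b)) ^ (p - 1) := by
        refine Real.rpow_le_rpow (div_nonneg (by linarith) (by positivity)) ?_ hp1.le
        gcongr
        linarith
    _ = 1 / ((2 : ℝ) ^ ((p + b + 3) * (p - 1)) * (12 * Real.exp 1) * B ^ (p - 1) *
          (p + 2) ^ p) := by
        rw [Real.div_rpow zero_le_one (by positivity), Real.one_rpow,
          Real.mul_rpow (by positivity) (by positivity),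
          Real.mul_rpow (by positivity) hB.le,
          Real.mul_rpow (by positivity) (by positivity),
          ← Real.rpow_mul (by norm_num), ← Real.rpow_mul (by positivity),
          ← Real.rpow_mul (by positivity), hbp', hbp, Real.rpow_one]
    _ ≤ _ := by
        gcongr
        · norm_num
        · nlinarith [sq_nonneg (p - 1)]

theorem rpow_constant_mul_le {p r k s : ℝ} (hp : 1 < p) (hr : 0 < r) (hk : r / 3 ≤ k)
    (hks : (r / 2) ^ 3 ≤ k * s ^ 2) :
    r ^ (p + 2) / ((2 : ℝ) ^ (5 * p - 4) * Real.exp 1 * (p + 2) ^ p) ≤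
      s ^ 2 * (k ^ p / (2 * p) ^ p) := by
  have hp0 : 0 < p := by linarith
  have hk0 : 0 < k := by linarith
  have hq : (3 : ℝ) ≤ ((p + 2) / p) ^ p := by
    have h := one_add_mul_self_le_rpow_one_add (s := 2 / p) (p := p)
      (by have : 0 < 2 / p := by positivity
          linarith) hp.le
    have e₁ : 1 + p * (2 / p) = 3 := by
      field_simp
      norm_num
    have e₂ : 1 + 2 / p = (p + 2) / p := by
      field_simp
    rwa [e₁, e₂] at h
  rw [Real.div_rpow (by positivity) hp0.le, le_div_iff₀ (by positivity)] at hq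
  have he : (8 : ℝ) ≤ 3 * Real.exp 1 := by linarith [Real.exp_one_gt_d9]
  have hkp : (r / 2) ^ 3 * (r / 3) ^ (p - 1) ≤ s ^ 2 * k ^ p := by
    have e : s ^ 2 * k ^ p = k * s ^ 2 * k ^ (p - 1) := by
      rw [Real.rpow_sub_one hk0.ne']
      field_simp
    rw [e]
    gcongr
  have hr2 : r ^ (p + 2) = r ^ 3 * r ^ (p - 1) := by
    rw [← Real.rpow_natCast r 3, ← Real.rpow_add hr]
    congr 1
    push_cast
    ring
  have h16 : (2 : ℝ) ^ (5 * p - 4) = 2 ^ p * 16 ^ (p - 1) := by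
    have : (16 : ℝ) = 2 ^ (4 : ℝ) := by norm_num
    rw [this, ← Real.rpow_mul (by norm_num), ← Real.rpow_add (by norm_num)]
    congr 1
    ring
  have h3 : (3 : ℝ) ^ (p - 1) ≤ 16 ^ (p - 1) :=
    Real.rpow_le_rpow (by norm_num) (by norm_num) (by linarith)
  rw [← mul_div_assoc]
  refine le_trans ?_ (div_le_div_of_nonneg_right hkp (by positivity))
  rw [Real.div_rpow hr.le (by norm_num), Real.mul_rpow (by norm_num) hp0.le, hr2, h16,
    div_le_div_iff₀ (by positivity) (by positivity)]
  have hmain : (8 : ℝ) * 3 ^ (p - 1) * p ^ p ≤ 16 ^ (p - 1) * Real.exp 1 * (p + 2) ^ p := by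
    calc (8 : ℝ) * 3 ^ (p - 1) * p ^ p ≤ 3 * Real.exp 1 * 16 ^ (p - 1) * p ^ p := by gcongr
      _ = 16 ^ (p - 1) * Real.exp 1 * (3 * p ^ p) := by ring
      _ ≤ _ := by gcongr
  have hcommon : 0 ≤ r ^ 3 * r ^ (p - 1) * 2 ^ p / (8 * 3 ^ (p - 1)) := by positivity
  have := mul_le_mul_of_nonneg_left hmain hcommon
  calc _ = r ^ 3 * r ^ (p - 1) * 2 ^ p / (8 * 3 ^ (p - 1)) * (8 * 3 ^ (p - 1) * p ^ p) := by
        field_simp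
    _ ≤ _ := this
    _ = _ := by
        field_simp
        norm_num

theorem half_pow_three_le (r : ℕ) (hr : 2 ≤ r) :
    ((r : ℝ) / 2) ^ 3 ≤ ((r / 2 : ℕ) : ℝ) * ((r - r / 2 : ℕ) : ℝ) ^ 2 := by
  obtain ⟨j, rfl | rfl⟩ : ∃ j, r = 2 * j ∨ r = 2 * j + 1 := ⟨r / 2, by omega⟩
  · have h₁ : 2 * j / 2 = j := by omega
    have h₂ : 2 * j - j = j := by omega
    rw [h₁, h₂]
    push_cast
    exact le_of_eq (by ring)
  · have h₁ : (2 * j + 1) / 2 = j := by omega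
    have h₂ : 2 * j + 1 - j = j + 1 := by omega
    have h₃ : (1 : ℝ) ≤ j := by
      have : 1 ≤ j := by omega
      exact_mod_cast this
    rw [h₁, h₂]
    push_cast
    nlinarith

/-- If `R(H, K_t) ≤ B·t^b` for all `t ≥ 1` (with `b > 1`, `B > 0`), then for
all `r ≥ 1`, `m_H(r) ≥ B'·r^(b/(b-1)+2)` where
`B' = ((1 − 2^(1−b)) / (2^(b/(b−1)+b+3) · (12e)^(b−1) · B · (b/(b−1)+2)^b))^(1/(b−1))`;
that is, every `H`-free 3-graph with chromatic number `> r` has at least that many edges. -/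
theorem mH_lower_of_ramsey_poly_upper
    (H : ThreeGraph) (b B : ℝ) (hb : 1 < b) (hB : 0 < B)
    (hR : ∀ t : ℕ, 1 ≤ t → (ramsey H t : ℝ) ≤ B * (t : ℝ) ^ b) :
    ∀ r : ℕ, 1 ≤ r → ∀ G : ThreeGraph, G.Free H → ¬ G.Colorable r →
      ((1 - (2 : ℝ) ^ (1 - b)) /
            ((2 : ℝ) ^ (b / (b - 1) + b + 3) * (12 * Real.exp 1) ^ (b - 1) * B *
              (b / (b - 1) + 2) ^ b)) ^ ((1 : ℝ) / (b - 1)) *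
          (r : ℝ) ^ (b / (b - 1) + 2)
        ≤ (G.edges.card : ℝ) := by
  intro r hr G hG hc
  have hb1 : 0 < b - 1 := by linarith
  have hconst := rpow_constant_le hb hB
  have hp1 : 1 < b / (b - 1) := by
    rw [one_lt_div hb1]
    linarith
  obtain rfl | hr2 : r = 1 ∨ 2 ≤ r := by omega
  · have hB1 : 1 ≤ B := by
      have h₁ := hR 1 le_rfl
      have h₂ : (1 : ℝ) ≤ ramsey H 1 := by exact_mod_cast hG.one_le_ramsey
      simp only [Nat.cast_one, Real.one_rpow, mul_one] at h₁
      linarith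
    have hE : 1 ≤ G.edges.card := by
      by_contra h
      have h0 : G.edges = ∅ := card_eq_zero.1 (by omega)
      exact hc ⟨fun _ => 0, by simp [h0]⟩
    have hE' : (1 : ℝ) ≤ G.edges.card := by exact_mod_cast hE
    rw [Nat.cast_one, Real.one_rpow, mul_one]
    refine (hconst.trans ?_).trans hE'
    have h₁ : 1 ≤ (2 : ℝ) ^ (5 * (b / (b - 1)) - 4) :=
      Real.one_le_rpow (by norm_num) (by linarith)
    have h₂ : 1 ≤ 12 * Real.exp 1 := by linarith [Real.exp_one_gt_d9]
    have h₃ : 1 ≤ B ^ (1 / (b - 1)) := Real.one_le_rpow hB1 (by positivity)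
    have h₄ : 1 ≤ (b / (b - 1) + 2) ^ (b / (b - 1)) :=
      Real.one_le_rpow (by linarith) (by linarith)
    refine div_le_one_of_le₀ ?_ (by positivity)
    exact one_le_mul_of_one_le_of_one_le
      (one_le_mul_of_one_le_of_one_le (one_le_mul_of_one_le_of_one_le h₁ h₂) h₃) h₄
  · have hsplit : r / 2 + (r - r / 2) = r := by omega
    have hlow := hG.le_card_edges_of_not_colorable hb hB hR (k := r / 2) (s := r - r / 2)
      (by omega) (by rwa [hsplit])
    have hr0 : (0 : ℝ) < r := by
      have : 0 < r := by omega
      exact_mod_cast this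
    have hk : (r : ℝ) / 3 ≤ ((r / 2 : ℕ) : ℝ) := by
      rw [div_le_iff₀ (by norm_num)]
      have : r ≤ r / 2 * 3 := by omega
      exact_mod_cast this
    have hmain := rpow_constant_mul_le hp1 hr0 hk (half_pow_three_le r hr2)
    have hBq : 0 < B ^ (1 / (b - 1)) := by positivity
    have hrp : 0 ≤ (r : ℝ) ^ (b / (b - 1) + 2) := by positivity
    refine (mul_le_mul_of_nonneg_right hconst hrp).trans ?_
    have hdiv := div_le_div_of_nonneg_right hmain hBq.le
    rw [mul_div_assoc, div_div] at hdiv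
    have h12 : (12 : ℝ) * (1 / ((2 : ℝ) ^ (5 * (b / (b - 1)) - 4) * (12 * Real.exp 1) *
        B ^ (1 / (b - 1)) * (b / (b - 1) + 2) ^ (b / (b - 1))) * (r : ℝ) ^ (b / (b - 1) + 2)) =
        (r : ℝ) ^ (b / (b - 1) + 2) / ((2 : ℝ) ^ (5 * (b / (b - 1)) - 4) * Real.exp 1 *
          (b / (b - 1) + 2) ^ (b / (b - 1)) * B ^ (1 / (b - 1))) := by
      generalize (r : ℝ) ^ (b / (b - 1) + 2) = R
      have hP : 0 < (b / (b - 1) + 2) ^ (b / (b - 1)) := by positivity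
      generalize (b / (b - 1) + 2) ^ (b / (b - 1)) = P at hP ⊢
      have hT : 0 < (2 : ℝ) ^ (5 * (b / (b - 1)) - 4) := by positivity
      generalize (2 : ℝ) ^ (5 * (b / (b - 1)) - 4) = T at hT ⊢
      generalize B ^ (1 / (b - 1)) = Q at hBq ⊢
      have he := Real.exp_pos 1
      field_simp
    rw [div_div] at hdiv
    linarith
end

section
/- There exists a constant C > 0 such that for all integers r ≥ 1 one has m_{C_3}(r) ≥ C·r^5. -/
/-- The loose cycle `C_3`: the 3-graph on 6 vertices with edges
`{1,2,3}, {3,4,5}, {5,6,1}` (here written 0-indexed). -/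
def looseC3 : ThreeGraph where
  n := 6
  edges := {({0, 1, 2} : Finset (Fin 6)), {2, 3, 4}, {4, 5, 0}}
  card_eq := by decide

namespace LooseTriangle

variable {V : Type*} [DecidableEq V]

/-- No six distinct vertices span a loose triangle. -/
def TriangleFree (E : Finset (Finset V)) : Prop :=
  ∀ x₀ x₁ x₂ x₃ x₄ x₅ : V, [x₀, x₁, x₂, x₃, x₄, x₅].Nodup →
    ({x₀, x₁, x₂} : Finset V) ∈ E → ({x₂, x₃, x₄} : Finset V) ∈ E →
    ({x₄, x₅, x₀} : Finset V) ∈ E → False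

/-- The number of edges containing both `x` and `y`. -/
def codeg (E : Finset (Finset V)) (x y : V) : ℕ := (E.filter fun e => x ∈ e ∧ y ∈ e).card

/-- The number of edges containing `v`. -/
def deg (E : Finset (Finset V)) (v : V) : ℕ := (E.filter fun e => v ∈ e).card

/-- `S` contains no edge. -/
def Indep (E : Finset (Finset V)) (S : Finset V) : Prop := ∀ e ∈ E, ¬ e ⊆ S

/-- The edges inside `W` can be properly coloured with `k` colours. -/
def ColorableOn (E : Finset (Finset V)) (W : Finset V) (k : ℕ) : Prop :=
  ∃ c : V → ℕ, (∀ v ∈ W, c v < k) ∧ ∀ e ∈ E, e ⊆ W → ∃ u ∈ e, ∃ v ∈ e, c u ≠ c v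

theorem codeg_comm (E : Finset (Finset V)) (x y : V) : codeg E x y = codeg E y x := by
  simp only [codeg, and_comm]

theorem pairwise_ne_of_card_three {x y z : V} (h : ({x, y, z} : Finset V).card = 3) :
    x ≠ y ∧ x ≠ z ∧ y ≠ z := by
  refine ⟨?_, ?_, ?_⟩ <;> rintro rfl
  · have := Finset.card_le_two (a := x) (b := z)
    simp at h; omega
  · have := Finset.card_le_two (a := y) (b := x)
    rw [Finset.insert_eq_of_mem (by simp)] at h; omega
  · have := Finset.card_le_two (a := x) (b := y)
    simp at h; omega

theorem exists_eq_triple {e : Finset V} (he : e.card = 3) {x : V} (hx : x ∈ e) :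
    ∃ y z, e = {x, y, z} := by
  have h : (e.erase x).card = 2 := by rw [Finset.card_erase_of_mem hx, he]
  obtain ⟨y, z, -, hyz⟩ := Finset.card_eq_two.1 h
  exact ⟨y, z, by rw [← Finset.insert_erase hx, hyz]⟩

theorem exists_eq_triple_of_ne {e : Finset V} (he : e.card = 3) {x y : V} (hx : x ∈ e)
    (hy : y ∈ e) (hxy : x ≠ y) : ∃ z, e = {x, y, z} := by
  obtain ⟨p, q, rfl⟩ := exists_eq_triple he hx
  simp only [Finset.mem_insert, Finset.mem_singleton] at hy
  rcases hy with rfl | rfl | rfl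
  · exact absurd rfl hxy
  · exact ⟨q, rfl⟩
  · exact ⟨p, by rw [Finset.pair_comm]⟩

section Uniform

variable {E : Finset (Finset V)}

/-- A pair of large codegree extends to an edge avoiding any given small set. -/
theorem exists_third (h3 : ∀ e ∈ E, e.card = 3) {x y : V} (hxy : x ≠ y) (F : Finset V)
    (h : F.card < codeg E x y) : ∃ z, z ∉ F ∧ ({x, y, z} : Finset V) ∈ E := by
  by_contra! hc
  have hsub : (E.filter fun e => x ∈ e ∧ y ∈ e) ⊆ F.image fun z => {x, y, z} := by
    intro e he
    obtain ⟨heE, hx, hy⟩ := Finset.mem_filter.1 he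
    obtain ⟨z, rfl⟩ := exists_eq_triple_of_ne (h3 e heE) hx hy hxy
    refine Finset.mem_image.2 ⟨z, ?_, rfl⟩
    by_contra hz
    exact hc z hz heE
  have := (Finset.card_le_card hsub).trans Finset.card_image_le
  unfold codeg at h
  omega

/-- An edge of a loose-triangle-free 3-graph has a pair of codegree at most three. -/
theorem not_all_heavy (h3 : ∀ e ∈ E, e.card = 3) (hE : TriangleFree E) {a b c : V}
    (he : ({a, b, c} : Finset V) ∈ E) (hab : 3 < codeg E a b) (hbc : 3 < codeg E b c)
    (hac : 3 < codeg E a c) : False := by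
  obtain ⟨nab, nac, nbc⟩ := pairwise_ne_of_card_three (h3 _ he)
  obtain ⟨x, hx, hxE⟩ := exists_third h3 nab {c} (by simp; omega)
  obtain ⟨y, hy, hyE⟩ := exists_third h3 nbc {a, x}
    (Finset.card_le_two.trans_lt (by omega))
  obtain ⟨z, hz, hzE⟩ := exists_third h3 nac {b, x, y}
    (Finset.card_le_three.trans_lt (by omega))
  obtain ⟨-, nax, nbx⟩ := pairwise_ne_of_card_three (h3 _ hxE)
  obtain ⟨-, nby, ncy⟩ := pairwise_ne_of_card_three (h3 _ hyE)
  obtain ⟨-, naz, ncz⟩ := pairwise_ne_of_card_three (h3 _ hzE)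
  simp only [Finset.mem_insert, Finset.mem_singleton, not_or] at hx hy hz
  refine hE a x b y c z ?_ ?_ ?_ ?_
  · simp only [List.nodup_cons, List.mem_cons, List.not_mem_nil, or_false, not_or]
    grind
  · rwa [Finset.pair_comm x b]
  · rwa [Finset.pair_comm y c]
  · rwa [Finset.pair_comm z a, Finset.insert_comm c a]

/-- No edge lies in the set of vertices that have large codegree with a given vertex. -/
theorem not_subset_heavy_neighbors (h3 : ∀ e ∈ E, e.card = 3) (hE : TriangleFree E) {a : V}
    {e : Finset V} (he : e ∈ E) (h : ∀ p ∈ e, a ≠ p ∧ 3 < codeg E a p) : False := by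
  obtain ⟨p, q, s, npq, nps, nqs, rfl⟩ := Finset.card_eq_three.1 (h3 e he)
  obtain ⟨nap, hp⟩ := h p (by simp)
  obtain ⟨naq, hq⟩ := h q (by simp)
  obtain ⟨nas, -⟩ := h s (by simp)
  obtain ⟨x, hx, hxE⟩ := exists_third h3 nap {q, s}
    (Finset.card_le_two.trans_lt (by omega))
  obtain ⟨y, hy, hyE⟩ := exists_third h3 naq {p, s, x}
    (Finset.card_le_three.trans_lt (by omega))
  obtain ⟨-, nax, npx⟩ := pairwise_ne_of_card_three (h3 _ hxE)
  obtain ⟨-, nay, nqy⟩ := pairwise_ne_of_card_three (h3 _ hyE)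
  simp only [Finset.mem_insert, Finset.mem_singleton, not_or] at hx hy
  refine hE a x p s q y ?_ ?_ ?_ ?_
  · simp only [List.nodup_cons, List.mem_cons, List.not_mem_nil, or_false, not_or]
    grind
  · rwa [Finset.pair_comm x p]
  · rwa [Finset.pair_comm s q]
  · rwa [Finset.pair_comm y a, Finset.insert_comm q a]

/-- If every `c ∈ S` is joined to `b` by an edge `{b, a c, c}` with `a c ∉ S`, and no edge inside
`S` has constant `a`, then `S` is independent. -/
theorem indep_of_link (h3 : ∀ e ∈ E, e.card = 3) (hE : TriangleFree E) (b : V) (S : Finset V)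
    (a : V → V) (ha : ∀ c ∈ S, ({b, a c, c} : Finset V) ∈ E) (haS : ∀ c ∈ S, a c ∉ S)
    (hfib : ∀ e ∈ E, e ⊆ S → ∃ c ∈ e, ∃ d ∈ e, a c ≠ a d) : Indep E S := by
  intro e he heS
  obtain ⟨c, hc, d, hd, hcd⟩ := hfib e he heS
  have ncd : c ≠ d := by rintro rfl; exact hcd rfl
  obtain ⟨z, rfl⟩ := exists_eq_triple_of_ne (h3 e he) hc hd ncd
  obtain ⟨-, ncz, ndz⟩ := pairwise_ne_of_card_three (h3 _ he)
  have hz : z ∈ S := heS (by simp)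
  have hcS := heS hc
  have hdS := heS hd
  obtain ⟨nba, nbc, nac⟩ := pairwise_ne_of_card_three (h3 _ (ha c hcS))
  obtain ⟨nba', nbd, nad⟩ := pairwise_ne_of_card_three (h3 _ (ha d hdS))
  obtain ⟨-, nbz, -⟩ := pairwise_ne_of_card_three (h3 _ (ha z hz))
  have h1 := haS c hcS
  have h2 := haS d hdS
  refine hE b (a c) c z d (a d) ?_ (ha c hcS) ?_ ?_
  · simp only [List.nodup_cons, List.mem_cons, List.not_mem_nil, or_false, not_or]
    grind
  · rwa [Finset.pair_comm z d]
  · have := ha d hdS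
    rwa [Finset.pair_comm, Finset.insert_comm, Finset.pair_comm] at this

/-- The edges at `v` in which both pairs through `v` have small codegree. -/
def lightEdges (E : Finset (Finset V)) (v : V) : Finset (Finset V) :=
  E.filter fun e => v ∈ e ∧ ∀ x ∈ e, x ≠ v → codeg E v x ≤ 3

theorem card_lightEdges_le (h3 : ∀ e ∈ E, e.card = 3) (hE : TriangleFree E) (v : V)
    (W : Finset V) (hW : ∀ e ∈ E, e ⊆ W) (α : ℕ) (hα : ∀ S ⊆ W, Indep E S → S.card ≤ α) :
    (lightEdges E v).card ≤ 6 * α := by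
  classical
  obtain ⟨M, hM, hmax⟩ := Finset.exists_max_image
    ((lightEdges E v).powerset.filter fun M => ∀ e ∈ M, ∀ f ∈ M, e ≠ f → ∀ x ∈ e, x ∈ f → x = v)
    Finset.card ⟨∅, by simp⟩
  obtain ⟨hMsub, hMdis⟩ := Finset.mem_filter.1 hM
  rw [Finset.mem_powerset] at hMsub
  have hlight : ∀ e ∈ lightEdges E v, e ∈ E ∧ v ∈ e ∧ ∀ x ∈ e, x ≠ v → codeg E v x ≤ 3 :=
    fun e he => Finset.mem_filter.1 he
  have hpq : ∀ f : Finset V, ∃ p q : V, f ∈ M → f = {v, q, p} := by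
    intro f
    by_cases hf : f ∈ M
    · obtain ⟨hfE, hvf, -⟩ := hlight f (hMsub hf)
      obtain ⟨q, p, h⟩ := exists_eq_triple (h3 f hfE) hvf
      exact ⟨p, q, fun _ => h⟩
    · exact ⟨v, v, fun h => absurd h hf⟩
  choose p q hpq using hpq
  have hne : ∀ f ∈ M, v ≠ q f ∧ v ≠ p f ∧ q f ≠ p f := fun f hf =>
    pairwise_ne_of_card_three (by rw [← hpq f hf]; exact h3 f (hlight f (hMsub hf)).1)
  have hpm : ∀ f ∈ M, p f ∈ f := fun f hf => by
    have h : p f ∈ ({v, q f, p f} : Finset V) := by simp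
    rwa [← hpq f hf] at h
  have hqm : ∀ f ∈ M, q f ∈ f := fun f hf => by
    have h : q f ∈ ({v, q f, p f} : Finset V) := by simp
    rwa [← hpq f hf] at h
  have hinj : Set.InjOn p M := by
    intro f hf g hg hfg
    by_contra hn
    exact (hne f hf).2.1 (hMdis f hf g hg hn (p f) (hpm f hf) (hfg ▸ hpm g hg)).symm
  have hcardM : (M.image p).card = M.card := Finset.card_image_of_injOn hinj
  have hg : ∀ c : V, ∃ f, c ∈ M.image p → f ∈ M ∧ p f = c := by
    intro c
    by_cases hc : c ∈ M.image p
    · obtain ⟨f, hf, h⟩ := Finset.mem_image.1 hc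
      exact ⟨f, fun _ => ⟨hf, h⟩⟩
    · exact ⟨∅, fun h => absurd h hc⟩
  choose g hg using hg
  have hind : Indep E (M.image p) := by
    refine indep_of_link h3 hE v _ (fun c => q (g c)) ?_ ?_ ?_
    · intro c hc
      obtain ⟨hgM, hgc⟩ := hg c hc
      have := hpq _ hgM
      rw [hgc] at this
      rw [← this]
      exact (hlight _ (hMsub hgM)).1
    · intro c hc hq
      obtain ⟨hgM, hgc⟩ := hg c hc
      obtain ⟨f, hf, hpf⟩ := Finset.mem_image.1 hq
      by_cases hfg : f = g c
      · subst hfg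
        exact (hne _ hgM).2.2 hpf.symm
      · exact (hne _ hf).2.1
          (hMdis f hf _ hgM hfg (p f) (hpm f hf) (hpf ▸ hqm _ hgM)).symm
    · intro e he heS
      obtain ⟨c, d, z, ncd, -, -, rfl⟩ := Finset.card_eq_three.1 (h3 e he)
      refine ⟨c, by simp, d, by simp, fun hcd => ?_⟩
      obtain ⟨hgc, hpc⟩ := hg c (heS (by simp))
      obtain ⟨hgd, hpd⟩ := hg d (heS (by simp))
      have hn : g c ≠ g d := fun h => ncd (by rw [← hpc, ← hpd, h])
      exact (hne _ hgc).1
        (hMdis _ hgc _ hgd hn (q (g c)) (hqm _ hgc) (by simpa only [hcd] using hqm _ hgd)).symm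
  have hsubW : M.image p ⊆ W := by
    intro c hc
    obtain ⟨f, hf, rfl⟩ := Finset.mem_image.1 hc
    exact hW f (hlight f (hMsub hf)).1 (hpm f hf)
  have hMα : M.card ≤ α := hcardM ▸ hα _ hsubW hind
  have hcover : lightEdges E v ⊆ M.biUnion fun f =>
      (f.erase v).biUnion fun x => E.filter fun e => v ∈ e ∧ x ∈ e := by
    intro e he
    obtain ⟨heE, hve, -⟩ := hlight e he
    simp only [Finset.mem_biUnion, Finset.mem_filter, Finset.mem_erase]
    by_cases heM : e ∈ M
    · exact ⟨e, heM, p e, ⟨(hne e heM).2.1.symm, hpm e heM⟩, heE, hve, hpm e heM⟩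
    · by_contra! hc
      have hbig : insert e M ∈ (lightEdges E v).powerset.filter fun M =>
          ∀ e ∈ M, ∀ f ∈ M, e ≠ f → ∀ x ∈ e, x ∈ f → x = v := by
        refine Finset.mem_filter.2 ⟨Finset.mem_powerset.2 (Finset.insert_subset he hMsub), ?_⟩
        intro e₁ h1 e₂ h2 hn x hx1 hx2
        by_contra hxv
        rcases Finset.mem_insert.1 h1 with k1 | k1 <;> rcases Finset.mem_insert.1 h2 with k2 | k2
        · exact hn (k1.trans k2.symm)
        · exact hc e₂ k2 x ⟨hxv, hx2⟩ heE hve (k1 ▸ hx1)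
        · exact hc e₁ k1 x ⟨hxv, hx1⟩ heE hve (k2 ▸ hx2)
        · exact hxv (hMdis e₁ k1 e₂ k2 hn x hx1 hx2)
      have := hmax _ hbig
      rw [Finset.card_insert_of_notMem heM] at this
      omega
  have hbound : (M.biUnion fun f =>
      (f.erase v).biUnion fun x => E.filter fun e => v ∈ e ∧ x ∈ e).card ≤ M.card * 6 := by
    refine Finset.card_biUnion_le_card_mul _ _ _ fun f hf => ?_
    obtain ⟨hfE, hvf, hfl⟩ := hlight f (hMsub hf)
    have h2 : (f.erase v).card = 2 := by rw [Finset.card_erase_of_mem hvf, h3 f hfE]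
    refine (Finset.card_biUnion_le_card_mul _ _ 3 fun x hx => ?_).trans (by omega)
    obtain ⟨hxv, hxf⟩ := Finset.mem_erase.1 hx
    exact hfl x hxf hxv
  have := Finset.card_le_card hcover
  omega

open Classical in
/-- The edges at `b` in which exactly one pair through `b` and the opposite pair have large
codegree. -/
noncomputable def leafEdges (E : Finset (Finset V)) (b : V) : Finset (Finset V) :=
  E.filter fun e => ∃ a c, e = {b, a, c} ∧ 3 < codeg E b a ∧ 3 < codeg E a c ∧ codeg E b c ≤ 3

theorem card_leafEdges_le (h3 : ∀ e ∈ E, e.card = 3) (hE : TriangleFree E) (b : V)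
    (W : Finset V) (hW : ∀ e ∈ E, e ⊆ W) (α : ℕ) (hα : ∀ S ⊆ W, Indep E S → S.card ≤ α) :
    (leafEdges E b).card ≤ 3 * α := by
  classical
  set S : Finset V := W.filter fun c => ∃ a, ({b, a, c} : Finset V) ∈ E ∧ 3 < codeg E b a ∧
    3 < codeg E a c ∧ codeg E b c ≤ 3 with hS
  have ha : ∀ c : V, ∃ a, c ∈ S → ({b, a, c} : Finset V) ∈ E ∧ 3 < codeg E b a ∧
      3 < codeg E a c ∧ codeg E b c ≤ 3 := by
    intro c
    by_cases hc : c ∈ S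
    · obtain ⟨a, h⟩ := (Finset.mem_filter.1 hc).2
      exact ⟨a, fun _ => h⟩
    · exact ⟨c, fun h => absurd h hc⟩
  choose a ha using ha
  have hind : Indep E S := by
    refine indep_of_link h3 hE b S a (fun c hc => (ha c hc).1) ?_ ?_
    · intro c hc h
      have h1 := (ha c hc).2.1
      have h2 := (ha _ h).2.2.2
      omega
    · intro e he heS
      by_contra! hc
      obtain ⟨x, hx⟩ : e.Nonempty := Finset.card_pos.1 (by rw [h3 e he]; norm_num)
      refine not_subset_heavy_neighbors h3 hE (a := a x) he fun p hp => ?_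
      obtain ⟨h1, -, h2, -⟩ := ha p (heS hp)
      rw [hc x hx p hp]
      exact ⟨(pairwise_ne_of_card_three (h3 _ h1)).2.2, h2⟩
  have hSα := hα S (Finset.filter_subset _ _) hind
  have hcover : leafEdges E b ⊆ S.biUnion fun c => E.filter fun e => b ∈ e ∧ c ∈ e := by
    intro e he
    obtain ⟨heE, a, c, rfl, h1, h2, h4⟩ := Finset.mem_filter.1 he
    simp only [Finset.mem_biUnion, Finset.mem_filter, hS]
    exact ⟨c, ⟨hW _ heE (by simp), a, heE, h1, h2, h4⟩, heE, by simp, by simp⟩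
  have hbound := Finset.card_biUnion_le_card_mul S
    (fun c => E.filter fun e => b ∈ e ∧ c ∈ e) 3 fun c hc => (ha c hc).2.2.2
  have := Finset.card_le_card hcover
  omega

/-- A loose-triangle-free 3-graph on `W` has at most `9 α |W|` edges, where `α` is its
independence number. -/
theorem card_edges_le (h3 : ∀ e ∈ E, e.card = 3) (hE : TriangleFree E)
    (W : Finset V) (hW : ∀ e ∈ E, e ⊆ W) (α : ℕ) (hα : ∀ S ⊆ W, Indep E S → S.card ≤ α) :
    E.card ≤ W.card * (9 * α) := by
  classical
  have hcover : E ⊆ W.biUnion fun v => lightEdges E v ∪ leafEdges E v := by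
    intro e he
    obtain ⟨x, y, z, nxy, nxz, nyz, rfl⟩ := Finset.card_eq_three.1 (h3 e he)
    have hx : x ∈ W := hW _ he (by simp)
    have hy : y ∈ W := hW _ he (by simp)
    have hz : z ∈ W := hW _ he (by simp)
    simp only [Finset.mem_biUnion, Finset.mem_union]
    have light : ∀ u v w : V, ({x, y, z} : Finset V) = {u, v, w} → codeg E u v ≤ 3 →
        codeg E u w ≤ 3 → ({x, y, z} : Finset V) ∈ lightEdges E u := by
      intro u v w h h1 h2
      refine Finset.mem_filter.2 ⟨he, by simp [h], fun t ht htu => ?_⟩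
      rw [h] at ht
      simp only [Finset.mem_insert, Finset.mem_singleton] at ht
      rcases ht with rfl | rfl | rfl
      · exact absurd rfl htu
      · exact h1
      · exact h2
    have leaf : ∀ b a c : V, ({x, y, z} : Finset V) = {b, a, c} → 3 < codeg E b a →
        3 < codeg E a c → codeg E b c ≤ 3 → ({x, y, z} : Finset V) ∈ leafEdges E b :=
      fun b a c h h1 h2 h4 => Finset.mem_filter.2 ⟨he, a, c, h, h1, h2, h4⟩
    have cyx := codeg_comm E x y
    have czx := codeg_comm E x z
    have czy := codeg_comm E y z
    have pyxz : ({x, y, z} : Finset V) = {y, x, z} := Finset.insert_comm _ _ _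
    have pxzy : ({x, y, z} : Finset V) = {x, z, y} := by rw [Finset.pair_comm]
    have pzxy : ({x, y, z} : Finset V) = {z, x, y} := by rw [pxzy, Finset.insert_comm]
    by_cases h1 : codeg E x y ≤ 3 <;> by_cases h2 : codeg E x z ≤ 3 <;>
      by_cases h4 : codeg E y z ≤ 3
    · exact ⟨x, hx, Or.inl (light x y z rfl h1 h2)⟩
    · exact ⟨x, hx, Or.inl (light x y z rfl h1 h2)⟩
    · exact ⟨y, hy, Or.inl (light y x z pyxz (by omega) h4)⟩
    · exact ⟨x, hx, Or.inr (leaf x z y pxzy (by omega) (by omega) h1)⟩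
    · exact ⟨z, hz, Or.inl (light z x y pzxy (by omega) (by omega))⟩
    · exact ⟨x, hx, Or.inr (leaf x y z rfl (by omega) (by omega) h2)⟩
    · exact ⟨y, hy, Or.inr (leaf y x z pyxz (by omega) (by omega) h4)⟩
    · exact (not_all_heavy h3 hE he (by omega) (by omega) (by omega)).elim
  refine (Finset.card_le_card hcover).trans (Finset.card_biUnion_le_card_mul _ _ _ fun v _ => ?_)
  have h1 := card_lightEdges_le h3 hE v W hW α hα
  have h2 := card_leafEdges_le h3 hE v W hW α hα
  have := Finset.card_union_le (lightEdges E v) (leafEdges E v)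
  omega

end Uniform

end LooseTriangle

namespace LooseTriangle

section Coloring

variable {V : Type*} {E : Finset (Finset V)}

theorem ColorableOn.mono {W : Finset V} {k l : ℕ} (h : ColorableOn E W k) (hkl : k ≤ l) :
    ColorableOn E W l := by
  obtain ⟨c, hc, hp⟩ := h
  exact ⟨c, fun v hv => (hc v hv).trans_le hkl, hp⟩

theorem Indep.colorableOn {W : Finset V} (h : Indep E W) : ColorableOn E W 1 :=
  ⟨fun _ => 0, fun _ _ => Nat.one_pos, fun e he heW => absurd heW (h e he)⟩

theorem ColorableOn.card_le {W : Finset V} {k α : ℕ} (h : ColorableOn E W k)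
    (hα : ∀ S ⊆ W, Indep E S → S.card ≤ α) : W.card ≤ α * k := by
  obtain ⟨c, hc, hp⟩ := h
  have := Finset.card_le_mul_card_image_of_maps_to (s := W) (t := Finset.range k) (f := c)
    (fun v hv => Finset.mem_range.2 (hc v hv)) α (fun i _ => by
      refine hα _ (Finset.filter_subset _ _) fun e he heS => ?_
      obtain ⟨u, hu, v, hv, huv⟩ := hp e he (heS.trans (Finset.filter_subset _ _))
      exact huv ((Finset.mem_filter.1 (heS hu)).2.trans (Finset.mem_filter.1 (heS hv)).2.symm))
  simpa using this

variable [DecidableEq V]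

open Classical in
/-- The colourings of all vertices that are proper on the edges inside `S`. -/
noncomputable def properOn [Fintype V] (E : Finset (Finset V)) (k : ℕ) (S : Finset V) :
    Finset (V → Fin k) :=
  Finset.univ.filter fun c => ∀ e ∈ E, e ⊆ S → ∃ u ∈ e, ∃ v ∈ e, c u ≠ c v

theorem mem_properOn [Fintype V] {k : ℕ} {S : Finset V} {c : V → Fin k} :
    c ∈ properOn E k S ↔ ∀ e ∈ E, e ⊆ S → ∃ u ∈ e, ∃ v ∈ e, c u ≠ c v := by
  classical
  simp [properOn]

theorem sq_mul_card_bad_le [Fintype V] {k : ℕ} {S : Finset V} {v : V} (hv : v ∉ S) {e : Finset V}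
    (he : e.card = 3) {a b : V} (hab : e = {v, a, b})
    (B : Finset (V → Fin k)) (hB : ∀ c ∈ B, c ∈ properOn E k S ∧ ∀ x ∈ e, ∀ y ∈ e, c x = c y) :
    B.card * (k * k) ≤ (properOn E k (S.erase a)).card := by
  classical
  subst hab
  obtain ⟨nva, nvb, nab⟩ := pairwise_ne_of_card_three he
  have hcard : (B ×ˢ (Finset.univ : Finset (Fin k × Fin k))).card = B.card * (k * k) := by
    simp
  rw [← hcard]
  refine Finset.card_le_card_of_injOn
    (fun p => Function.update (Function.update p.1 a p.2.1) v p.2.2) ?_ ?_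
  · rintro ⟨c, i, j⟩ hp
    have hc : c ∈ B := (Finset.mem_product.1 hp).1
    have hcS := mem_properOn.1 (hB c hc).1
    refine mem_properOn.2 fun f hf hfS => ?_
    obtain ⟨x, hx, y, hy, hxy⟩ := hcS f hf (hfS.trans (Finset.erase_subset _ _))
    have key : ∀ z ∈ f, Function.update (Function.update c a i) v j z = c z := by
      intro z hz
      obtain ⟨hza, hzS⟩ := Finset.mem_erase.1 (hfS hz)
      have hzv : z ≠ v := by rintro rfl; exact hv hzS
      rw [Function.update_of_ne hzv, Function.update_of_ne hza]
    refine ⟨x, hx, y, hy, ?_⟩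
    simp only [key x hx, key y hy]
    exact hxy
  · rintro ⟨c, i, j⟩ hp ⟨c', i', j'⟩ hp' h
    have hc := (hB c (Finset.mem_product.1 hp).1).2
    have hc' := (hB c' (Finset.mem_product.1 hp').1).2
    simp only at h
    have h1 := congrFun h v
    have h2 := congrFun h a
    have h3 := congrFun h b
    simp only [Function.update_self] at h1
    simp only [Function.update_of_ne nva.symm, Function.update_self] at h2
    simp only [Function.update_of_ne nvb.symm, Function.update_of_ne nab.symm] at h3
    have hcc : c = c' := by
      funext z
      by_cases hzv : z = v
      · rw [hzv, hc v (by simp) b (by simp), hc' v (by simp) b (by simp), h3]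
      by_cases hza : z = a
      · rw [hza, hc a (by simp) b (by simp), hc' a (by simp) b (by simp), h3]
      have := congrFun h z
      simpa only [Function.update_of_ne hzv, Function.update_of_ne hza] using this
    rw [hcc, h1, h2]

/-- Rosenfeld's counting form of the local lemma: adding a vertex to `S` loses at most half of
the proper colourings. -/
theorem card_properOn_le [Fintype V] (h3 : ∀ e ∈ E, e.card = 3) {k : ℕ} (hk : 0 < k)
    (hdeg : ∀ v, 4 * deg E v ≤ k * k) (S : Finset V) (v : V) (hv : v ∉ S) :
    (properOn E k S).card ≤ 2 * (properOn E k (insert v S)).card := by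
  classical
  induction S using Finset.strongInduction generalizing v with
  | H S ih =>
    set N := (properOn E k S).card with hN
    set F := E.filter fun e => v ∈ e with hF
    set B : Finset V → Finset (V → Fin k) := fun e =>
      (properOn E k S).filter fun c => e ⊆ insert v S ∧ ∀ x ∈ e, ∀ y ∈ e, c x = c y with hBdef
    have hcover : properOn E k S ⊆ properOn E k (insert v S) ∪ F.biUnion B := by
      intro c hc
      by_contra hcon
      simp only [Finset.mem_union, not_or, Finset.mem_biUnion, not_exists, not_and] at hcon
      refine hcon.1 (mem_properOn.2 fun e he heS => ?_)
      by_contra! hmono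
      by_cases hve : v ∈ e
      · exact hcon.2 e (Finset.mem_filter.2 ⟨he, hve⟩)
          (Finset.mem_filter.2 ⟨hc, heS, hmono⟩)
      · obtain ⟨x, hx, y, hy, hxy⟩ := mem_properOn.1 hc e he
          ((Finset.subset_insert_iff_of_notMem hve).1 heS)
        exact hxy (hmono x hx y hy)
    have hB : ∀ e ∈ F, (B e).card * (k * k) ≤ 2 * N := by
      intro e heF
      obtain ⟨heE, hve⟩ := Finset.mem_filter.1 heF
      by_cases heS : e ⊆ insert v S
      · obtain ⟨a, b, hab⟩ := exists_eq_triple (h3 e heE) hve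
        have haS : a ∈ S := by
          have hav : v ≠ a := (pairwise_ne_of_card_three (hab ▸ h3 e heE)).1
          exact (Finset.mem_insert.1 (heS (by simp [hab]))).resolve_left hav.symm
        have h1 := sq_mul_card_bad_le (E := E) hv (h3 e heE) hab (B e)
          fun c hc => ⟨(Finset.mem_filter.1 hc).1, (Finset.mem_filter.1 hc).2.2⟩
        have h2 := ih (S.erase a) (Finset.erase_ssubset haS) a (Finset.notMem_erase _ _)
        rw [Finset.insert_erase haS] at h2
        exact h1.trans h2
      · have : B e = ∅ := by
          rw [Finset.filter_eq_empty_iff]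
          exact fun c _ h => heS h.1
        simp [this]
    have h1 : N ≤ (properOn E k (insert v S)).card + ∑ e ∈ F, (B e).card :=
      (Finset.card_le_card hcover).trans ((Finset.card_union_le _ _).trans
        (Nat.add_le_add_left Finset.card_biUnion_le _))
    have h2 : (∑ e ∈ F, (B e).card) * (k * k) ≤ F.card * (2 * N) := by
      rw [Finset.sum_mul]
      exact Finset.sum_le_card_nsmul _ _ _ hB
    have h4 : 4 * F.card ≤ k * k := hdeg v
    have hkk : 0 < k * k := Nat.mul_pos hk hk
    have h5 : 2 * (∑ e ∈ F, (B e).card) ≤ N := by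
      refine Nat.le_of_mul_le_mul_right ?_ hkk
      nlinarith [Nat.mul_le_mul_right N h4]
    omega

/-- A 3-graph of maximum degree at most `k² / 4` is `k`-colourable. -/
theorem exists_proper_of_deg_le [Fintype V] (h3 : ∀ e ∈ E, e.card = 3) {k : ℕ} (hk : 0 < k)
    (hdeg : ∀ v, 4 * deg E v ≤ k * k) :
    ∃ c : V → Fin k, ∀ e ∈ E, ∃ u ∈ e, ∃ v ∈ e, c u ≠ c v := by
  have hpos : ∀ S : Finset V, 0 < (properOn E k S).card := by
    intro S
    induction S using Finset.induction_on with
    | empty =>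
      refine Finset.card_pos.2 ⟨fun _ => ⟨0, hk⟩, mem_properOn.2 fun e he hS => ?_⟩
      have := h3 e he
      rw [Finset.subset_empty.1 hS] at this
      simp at this
    | insert v S hv ih =>
      have := card_properOn_le h3 hk hdeg S v hv
      omega
  obtain ⟨c, hc⟩ := Finset.card_pos.1 (hpos Finset.univ)
  exact ⟨c, fun e he => mem_properOn.1 hc e he (Finset.subset_univ _)⟩

theorem colorableOn_of_deg_le [Fintype V] (h3 : ∀ e ∈ E, e.card = 3) {k : ℕ} (hk : 0 < k)
    (W : Finset V) (hdeg : ∀ v ∈ W, 4 * deg (E.filter (· ⊆ W)) v ≤ k * k) :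
    ColorableOn E W k := by
  obtain ⟨c, hc⟩ := exists_proper_of_deg_le (E := E.filter (· ⊆ W))
    (fun e he => h3 e (Finset.mem_filter.1 he).1) hk (fun v => by
      by_cases hv : v ∈ W
      · exact hdeg v hv
      · have : deg (E.filter (· ⊆ W)) v = 0 := by
          refine Finset.card_eq_zero.2 (Finset.filter_eq_empty_iff.2 fun e he hve => hv ?_)
          exact (Finset.mem_filter.1 he).2 hve
        simp [this])
  refine ⟨fun v => c v, fun v _ => (c v).2, fun e he heW => ?_⟩
  obtain ⟨u, hu, v, hv, huv⟩ := hc e (Finset.mem_filter.2 ⟨he, heW⟩)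
  exact ⟨u, hu, v, hv, fun h => huv (Fin.ext h)⟩

theorem ColorableOn.union {W₁ W₂ : Finset V} {k₁ k₂ : ℕ} (h₁ : ColorableOn E W₁ k₁)
    (h₂ : ColorableOn E W₂ k₂) : ColorableOn E (W₁ ∪ W₂) (k₁ + k₂) := by
  obtain ⟨c₁, hc₁, hp₁⟩ := h₁
  obtain ⟨c₂, hc₂, hp₂⟩ := h₂
  refine ⟨fun v => if v ∈ W₁ then c₁ v else k₁ + c₂ v, fun v hv => ?_, fun e he heW => ?_⟩
  · by_cases h : v ∈ W₁
    · have := hc₁ v h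
      simp only [h, if_true]; omega
    · have := hc₂ v ((Finset.mem_union.1 hv).resolve_left h)
      simp only [h, if_false]; omega
  · by_contra! hmono
    by_cases h : e ⊆ W₁
    · obtain ⟨u, hu, v, hv, huv⟩ := hp₁ e he h
      have := hmono u hu v hv
      simp only [h hu, h hv, if_true] at this
      exact huv this
    · obtain ⟨x, hx, hxW⟩ := Finset.not_subset.1 h
      have hout : ∀ u ∈ e, u ∉ W₁ := by
        intro u hu huW
        have h1 := hmono u hu x hx
        have h2 := hc₁ u huW
        simp only [huW, hxW, if_true, if_false] at h1
        omega
      obtain ⟨u, hu, v, hv, huv⟩ := hp₂ e he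
        fun u hu => (Finset.mem_union.1 (heW hu)).resolve_left (hout u hu)
      have := hmono u hu v hv
      simp only [hout u hu, hout v hv, if_false] at this
      omega

theorem sum_deg_le (h3 : ∀ e ∈ E, e.card = 3) (W : Finset V) :
    ∑ v ∈ W, deg E v ≤ 3 * E.card := by
  have h := Finset.sum_card_bipartiteAbove_eq_sum_card_bipartiteBelow (s := W) (t := E)
    (fun v e => v ∈ e)
  have h1 : ∑ v ∈ W, deg E v = ∑ e ∈ E, (W.filter fun v => v ∈ e).card := h
  rw [h1, mul_comm]
  refine Finset.sum_le_card_nsmul _ _ _ fun e he => ?_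
  rw [← h3 e he]
  exact Finset.card_le_card fun v hv => (Finset.mem_filter.1 hv).2

/-- A loose-triangle-free 3-graph on `W` with independence number at most `α` has `O(α^(3/2))`
vertices. -/
theorem card_le_of_indep_le [Fintype V] (h3 : ∀ e ∈ E, e.card = 3) (hE : TriangleFree E)
    (W : Finset V) (α q : ℕ) (hα : ∀ S ⊆ W, Indep E S → S.card ≤ α) (hq : 0 < q)
    (hαq : 216 * α ≤ q * q) : W.card ≤ 2 * (α * q) := by
  classical
  set E' := E.filter (· ⊆ W) with hE'
  have hsub : E' ⊆ E := Finset.filter_subset _ _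
  have h3' : ∀ e ∈ E', e.card = 3 := fun e he => h3 e (hsub he)
  have hcard : E'.card ≤ W.card * (9 * α) := by
    refine card_edges_le h3' ?_ W (fun e he => (Finset.mem_filter.1 he).2) α ?_
    · exact fun a b c d e f hn h1 h2 h4 => hE a b c d e f hn (hsub h1) (hsub h2) (hsub h4)
    · intro S hS hind
      exact hα S hS fun e he heS => hind e (Finset.mem_filter.2 ⟨he, heS.trans hS⟩) heS
  set L := W.filter fun v => deg E' v ≤ 54 * α with hL
  set H := W.filter fun v => ¬ deg E' v ≤ 54 * α with hH
  have hLH : L.card + H.card = W.card := Finset.card_filter_add_card_filter_not _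
  have hsum : H.card * (54 * α + 1) ≤ 3 * E'.card := by
    refine le_trans ?_ (sum_deg_le h3' H)
    rw [← smul_eq_mul]
    refine Finset.card_nsmul_le_sum H _ _ fun v hv => ?_
    have := (Finset.mem_filter.1 hv).2
    omega
  have hhalf : W.card ≤ 2 * L.card := by
    by_contra! hlt
    have : W.card + 1 ≤ 2 * H.card := by omega
    nlinarith [Nat.mul_le_mul_right (27 * α) this]
  have hcol : ColorableOn E L q := by
    refine colorableOn_of_deg_le h3 hq L fun v hv => ?_
    have h1 := (Finset.mem_filter.1 hv).2
    have h2 : deg (E.filter (· ⊆ L)) v ≤ deg E' v := by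
      refine Finset.card_le_card (Finset.filter_subset_filter _ fun e he => ?_)
      obtain ⟨heE, heL⟩ := Finset.mem_filter.1 he
      exact Finset.mem_filter.2 ⟨heE, heL.trans (Finset.filter_subset _ _)⟩
    omega
  have := hcol.card_le fun S hS => hα S (hS.trans (Finset.filter_subset _ _))
  omega

/-- A loose-triangle-free 3-graph on about `k³` vertices has an independent set of order `k²`. -/
theorem exists_indep [Fintype V] (h3 : ∀ e ∈ E, e.card = 3) (hE : TriangleFree E)
    (W : Finset V) (k : ℕ) (hk : k ^ 3 < 1000000 * W.card) :
    ∃ S ⊆ W, Indep E S ∧ 3 * (k + 1) ^ 2 ≤ 1000000 * S.card := by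
  by_cases hsmall : 3 * (k + 1) ^ 2 ≤ 1000000
  · have hW : 0 < W.card := by
      rcases Nat.eq_zero_or_pos W.card with h | h
      · simp [h] at hk
      · exact h
    obtain ⟨w, hw⟩ := Finset.card_pos.1 hW
    refine ⟨{w}, Finset.singleton_subset_iff.2 hw, fun e he hes => ?_, by simpa using hsmall⟩
    have := Finset.card_le_card hes
    rw [h3 e he] at this
    simp at this
  · by_contra! hcon
    have hk' : 576 ≤ k := by
      by_contra! hlt
      have : (k + 1) ^ 2 ≤ 576 ^ 2 := Nat.pow_le_pow_left (by omega) 2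
      omega
    obtain ⟨α, hαdef⟩ : ∃ α, α = 3 * (k + 1) ^ 2 / 1000000 := ⟨_, rfl⟩
    have hMα : 1000000 * α ≤ 3 * (k + 1) ^ 2 := by omega
    obtain ⟨q, hqdef⟩ : ∃ q, q = k / 7 := ⟨_, rfl⟩
    have hq1 : 7 * q ≤ k := by omega
    have hq2 : k + 1 ≤ 8 * q := by omega
    have hW := card_le_of_indep_le h3 hE W α q (fun S hS hind => by
      have := hcon S hS hind
      omega) (by omega) (by nlinarith)
    have h1 : 1000000 * W.card ≤ 6 * (k + 1) ^ 2 * q := by nlinarith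
    have h2 : k ^ 3 < 6 * (k + 1) ^ 2 * q := hk.trans_le h1
    have h4 : 7 * k ^ 3 < 6 * (k + 1) ^ 2 * k := by nlinarith
    nlinarith

/-- A loose-triangle-free 3-graph on `n` vertices is `O(n^(1/3))`-colourable. -/
theorem colorableOn_of_card_le [Fintype V] (h3 : ∀ e ∈ E, e.card = 3) (hE : TriangleFree E)
    (k : ℕ) (W : Finset V) (hW : 1000000 * W.card ≤ k ^ 3) : ColorableOn E W k := by
  induction k generalizing W with
  | zero =>
    have : W = ∅ := Finset.card_eq_zero.1 (by simpa using hW)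
    subst this
    refine ⟨fun _ => 0, by simp, fun e he hes => ?_⟩
    have := h3 e he
    rw [Finset.subset_empty.1 hes] at this
    simp at this
  | succ k ih =>
    rcases Nat.lt_or_ge (k ^ 3) (1000000 * W.card) with hlt | hge
    · obtain ⟨S, hSW, hS, hcard⟩ := exists_indep h3 hE W k hlt
      have h1 := Finset.card_sdiff_add_card_eq_card hSW
      have hcube : (k + 1) ^ 3 + (3 * k + 2) = k ^ 3 + 3 * (k + 1) ^ 2 := by ring
      have h2 := ih (W \ S) (by omega)
      have := h2.union hS.colorableOn
      rwa [Finset.sdiff_union_of_subset hSW] at this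
    · exact (ih W hge).mono (Nat.le_succ k)

/-- A loose-triangle-free 3-graph with few edges is `2k`-colourable. -/
theorem colorableOn_univ [Fintype V] (h3 : ∀ e ∈ E, e.card = 3) (hE : TriangleFree E)
    {k : ℕ} (hk : 0 < k) (hcard : 12000000 * E.card ≤ k ^ 5) :
    ColorableOn E Finset.univ (k + k) := by
  classical
  set L := Finset.univ.filter fun v => 4 * deg E v ≤ k * k with hL
  set H := Finset.univ.filter fun v => ¬ 4 * deg E v ≤ k * k with hH
  have hLH : L ∪ H = Finset.univ := Finset.filter_union_filter_not_eq _ _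
  have hcolL : ColorableOn E L k := by
    refine colorableOn_of_deg_le h3 hk L fun v hv => ?_
    have h1 := (Finset.mem_filter.1 hv).2
    have h2 : deg (E.filter (· ⊆ L)) v ≤ deg E v :=
      Finset.card_le_card (Finset.filter_subset_filter _ (Finset.filter_subset _ _))
    omega
  have hsum : H.card * (k * k) ≤ 4 * (3 * E.card) := by
    refine le_trans ?_ (Nat.mul_le_mul_left 4 (sum_deg_le h3 H))
    rw [Finset.mul_sum]
    refine Finset.card_nsmul_le_sum H _ _ fun v hv => ?_
    have := (Finset.mem_filter.1 hv).2
    omega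
  have hcolH : ColorableOn E H k := by
    refine colorableOn_of_card_le h3 hE k H ?_
    refine Nat.le_of_mul_le_mul_right (c := k * k) ?_ (Nat.mul_pos hk hk)
    calc 1000000 * H.card * (k * k) ≤ 12000000 * E.card := by nlinarith
      _ ≤ k ^ 5 := hcard
      _ = k ^ 3 * (k * k) := by ring
  rw [← hLH]
  exact hcolL.union hcolH

end Coloring

end LooseTriangle

theorem ThreeGraph.Free.triangleFree {G : ThreeGraph} (hG : G.Free looseC3) :
    LooseTriangle.TriangleFree G.edges := by
  intro x₀ x₁ x₂ x₃ x₄ x₅ hnodup h1 h2 h3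
  have hinj : Function.Injective (![x₀, x₁, x₂, x₃, x₄, x₅] : Fin 6 → Fin G.n) := by
    have hget := List.nodup_iff_injective_get.1 hnodup
    have key : ∀ i : Fin 6, [x₀, x₁, x₂, x₃, x₄, x₅].get i = ![x₀, x₁, x₂, x₃, x₄, x₅] i := by
      intro i
      fin_cases i <;> rfl
    intro i j hij
    exact hget ((key i).trans (hij.trans (key j).symm))
  have himage : ∀ e ∈ ({{0, 1, 2}, {2, 3, 4}, {4, 5, 0}} : Finset (Finset (Fin 6))),
      e.image ![x₀, x₁, x₂, x₃, x₄, x₅] ∈ G.edges := by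
    intro e he
    simp only [Finset.mem_insert, Finset.mem_singleton] at he
    rcases he with rfl | rfl | rfl <;> simpa [Finset.image_insert]
  exact hG ⟨⟨_, hinj⟩, himage⟩

theorem ThreeGraph.colorable_of_colorableOn {G : ThreeGraph} {k r : ℕ} (hkr : k ≤ r)
    (h : LooseTriangle.ColorableOn G.edges Finset.univ k) : G.Colorable r := by
  obtain ⟨c, hc, hp⟩ := h
  refine ⟨fun v => ⟨c v, (hc v (Finset.mem_univ v)).trans_le hkr⟩, fun e he => ?_⟩
  obtain ⟨u, hu, v, hv, huv⟩ := hp e he (Finset.subset_univ _)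
  exact ⟨u, hu, v, hv, fun h => huv (congrArg Fin.val h)⟩

/-- There is a constant `C > 0` such that `m_{C_3}(r) ≥ C·r^5` for all `r ≥ 1`:
every `C_3`-free 3-graph with chromatic number `> r` has at least `C·r^5` edges. -/
theorem mH_looseC3_lower :
    ∃ C : ℝ, 0 < C ∧ ∀ r : ℕ, 1 ≤ r → ∀ G : ThreeGraph, G.Free looseC3 → ¬ G.Colorable r →
      C * (r : ℝ) ^ 5 ≤ (G.edges.card : ℝ) := by
  refine ⟨1 / 2916000000, by norm_num, fun r hr G hfree hcol => ?_⟩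
  have key : r ^ 5 ≤ 2916000000 * G.edges.card := by
    rcases Nat.lt_or_ge r 2 with h | h
    · have hr1 : r = 1 := by omega
      have : 0 < G.edges.card := by
        rcases Nat.eq_zero_or_pos G.edges.card with h0 | h0
        · refine absurd ⟨fun _ => ⟨0, hr⟩, fun e he => ?_⟩ hcol
          rw [Finset.card_eq_zero.1 h0] at he
          simp at he
        · exact h0
      subst hr1
      omega
    · obtain ⟨k, hk⟩ : ∃ k, k = r / 2 := ⟨_, rfl⟩
      have hlt : k ^ 5 < 12000000 * G.edges.card := by
        by_contra! hle
        exact hcol (ThreeGraph.colorable_of_colorableOn (by omega)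
          (LooseTriangle.colorableOn_univ G.card_eq hfree.triangleFree (by omega) hle))
      have h1 : r ^ 5 ≤ (3 * k) ^ 5 := Nat.pow_le_pow_left (by omega) 5
      rw [mul_pow] at h1
      omega
  have : (r : ℝ) ^ 5 ≤ 2916000000 * (G.edges.card : ℝ) := by exact_mod_cast key
  linarith
end

section
/- There exists a constant C > 0 such that for all integers r ≥ 2 one has m_{C_3}(r) ≤ C·r^5·(ln r)^{5/2}. -/
namespace LooseTriangle
open Finset

/-- `p`, `y`, `w` form a block. -/
def IsBlock {I A J : Type*} (g : I → A) (j : I → J) (lab : I → Fin 3 × A × J) (p y w : I) :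
    Prop :=
  (lab p).1 = 0 ∧ (lab y).1 = 1 ∧ (lab w).1 = 2 ∧ (lab y).2.1 = g p ∧ (lab w).2.2 = j p

section Template
variable {I A J : Type*} {g : I → A} {j : I → J} {lab : I → Fin 3 × A × J}

/-- No three blocks form a loose triangle. -/
theorem IsBlock.no_triangle [DecidableEq I] (hinj : Function.Injective fun p => (g p, j p))
    {v : Fin 6 → I} (hv : Function.Injective v) {p y w : Fin 3 → I}
    (h : ∀ i, IsBlock g j lab (p i) (y i) (w i))
    (h0 : ({v 0, v 1, v 2} : Finset I) = {p 0, y 0, w 0})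
    (h1 : ({v 2, v 3, v 4} : Finset I) = {p 1, y 1, w 1})
    (h2 : ({v 4, v 5, v 0} : Finset I) = {p 2, y 2, w 2}) : False := by
  have key : ∀ (i : Fin 3) (u : I), u ∈ ({p i, y i, w i} : Finset I) →
      (u = p i ∧ (lab u).1 = 0) ∨ (u = y i ∧ (lab u).1 = 1) ∨ (u = w i ∧ (lab u).1 = 2) := by
    intro i u hu
    simp only [mem_insert, mem_singleton] at hu
    obtain ⟨a, b, c, -⟩ := h i
    rcases hu with rfl | rfl | rfl <;> simp [a, b, c]
  have ne : ∀ {a b : Fin 6}, a ≠ b → v a ≠ v b := fun hab h => hab (hv h)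
  have a0 := key 0 (v 0) (by rw [← h0]; simp)
  have a2 := key 0 (v 2) (by rw [← h0]; simp)
  have b2 := key 1 (v 2) (by rw [← h1]; simp)
  have b4 := key 1 (v 4) (by rw [← h1]; simp)
  have c4 := key 2 (v 4) (by rw [← h2]; simp)
  have c0 := key 2 (v 0) (by rw [← h2]; simp)
  have m0 : p 0 ∈ ({v 0, v 1, v 2} : Finset I) := by rw [h0]; simp
  have m1 : p 1 ∈ ({v 2, v 3, v 4} : Finset I) := by rw [h1]; simp
  have m2 : p 2 ∈ ({v 4, v 5, v 0} : Finset I) := by rw [h2]; simp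
  simp only [mem_insert, mem_singleton] at m0 m1 m2
  obtain ⟨-, -, -, g0, j0⟩ := h 0
  obtain ⟨-, -, -, g1, j1⟩ := h 1
  obtain ⟨-, -, -, g2, j2⟩ := h 2
  have e (a b : Fin 3) (hg : g (p a) = g (p b)) (hj : j (p a) = j (p b)) : p a = p b :=
    hinj (Prod.ext hg hj)
  have e01 := e 0 1
  have e02 := e 0 2
  have e12 := e 1 2
  have n02 : v 0 ≠ v 2 := ne (by decide)
  have n04 : v 0 ≠ v 4 := ne (by decide)
  have n24 : v 2 ≠ v 4 := ne (by decide)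
  have n03 : v 0 ≠ v 3 := ne (by decide)
  have n14 : v 1 ≠ v 4 := ne (by decide)
  have n25 : v 2 ≠ v 5 := ne (by decide)
  clear h0 h1 h2 h key hv hinj e ne
  grind (splits := 20)

end Template

theorem one_sub_pow_le {z : ℝ} (hz : 0 ≤ z) (hz1 : z ≤ 1) (n : ℕ) :
    (1 - z) ^ n ≤ 1 / (1 + n * z) := by
  have h1 : 1 + n * z ≤ (1 + z) ^ n := one_add_mul_le_pow (by linarith) n
  rw [le_div_iff₀ (by positivity)]
  calc (1 - z) ^ n * (1 + n * z) ≤ (1 - z) ^ n * (1 + z) ^ n := by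
        have : 0 ≤ (1 - z) ^ n := pow_nonneg (by linarith) n
        gcongr
    _ = (1 - z ^ 2) ^ n := by rw [← mul_pow]; ring
    _ ≤ 1 := pow_le_one₀ (by nlinarith) (by nlinarith)

theorem card_comp_mem {I K L : Type*} [Fintype I] [Fintype K] [Fintype L] [DecidableEq I]
    [DecidableEq K] {Φ : K → I} (hΦ : Function.Injective Φ) (T : Set (K → L)) :
    Nat.card {lab : I → L // lab ∘ Φ ∈ T} * Fintype.card L ^ Fintype.card K =
      Nat.card T * Fintype.card L ^ Fintype.card I := by
  classical
  let C := {i // i ∈ (Set.range Φ)ᶜ}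
  let e : K ⊕ C ≃ I := (Equiv.sumCongr (Equiv.ofInjective Φ hΦ) (Equiv.refl _)).trans
    (Equiv.Set.sumCompl (Set.range Φ))
  let e2 : (I → L) ≃ (K → L) × (C → L) :=
    (Equiv.arrowCongr e.symm (Equiv.refl L)).trans (Equiv.sumArrowEquivProdArrow K C L)
  have he : ∀ lab, (e2 lab).1 = lab ∘ Φ := by
    intro lab
    funext k
    rfl
  have hc : Fintype.card I = Fintype.card K + Fintype.card C := by
    rw [← Fintype.card_sum, Fintype.card_congr e]
  let e3 : {lab : I → L // lab ∘ Φ ∈ T} ≃ T × (C → L) :=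
    { toFun := fun x => (⟨(e2 x.1).1, by rw [he]; exact x.2⟩, (e2 x.1).2)
      invFun := fun x => ⟨e2.symm (x.1.1, x.2), by
        rw [← he, Equiv.apply_symm_apply]; exact x.1.2⟩
      left_inv := fun x => by simp
      right_inv := fun x => by simp }
  rw [Nat.card_congr e3, Nat.card_prod, hc, pow_add, Nat.card_eq_fintype_card (α := C → L),
    Fintype.card_fun]
  ring

theorem exists_monochromatic_chunks {I K : Type*} [Fintype I] [Fintype K] [DecidableEq I] {r : ℕ}
    (χ : I → Fin r) (n : ℕ) :
    ∀ S : Finset I, (r + n) * Fintype.card K ≤ #S →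
      ∃ Φ : Fin n → K → I, Function.Injective (fun x : Fin n × K => Φ x.1 x.2) ∧
        (∀ c k, Φ c k ∈ S) ∧ ∀ c k k', χ (Φ c k) = χ (Φ c k') := by
  classical
  induction n with
  | zero =>
    intro S _
    exact ⟨fun c => c.elim0, fun x => x.1.elim0, fun c => c.elim0, fun c => c.elim0⟩
  | succ n ih =>
    intro S hS
    rcases isEmpty_or_nonempty K with hK | hK
    · exact ⟨fun _ k => hK.elim k, fun x => hK.elim x.2, fun _ k => hK.elim k,
        fun _ k => hK.elim k⟩
    have hpos : 0 < Fintype.card K := Fintype.card_pos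
    have hSne : 0 < #S := lt_of_lt_of_le (by positivity) hS
    obtain ⟨i0, -⟩ := Finset.card_pos.1 hSne
    have hr : 0 < r := (χ i0).pos
    obtain ⟨d, -, hd⟩ := Finset.exists_le_card_fiber_of_mul_le_card_of_maps_to
      (s := S) (t := (univ : Finset (Fin r))) (f := χ) (n := Fintype.card K)
      (fun _ _ => mem_univ _) ⟨⟨0, hr⟩, mem_univ _⟩ (by
        rw [card_univ, Fintype.card_fin]; nlinarith)
    obtain ⟨B, hB, hBc⟩ := Finset.exists_subset_card_eq hd
    have hBS : B ⊆ S := hB.trans (filter_subset _ _)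
    obtain ⟨Φ, h1, h2, h3⟩ := ih (S \ B) (by
      rw [card_sdiff_of_subset hBS, hBc]
      have : (r + (n + 1)) * Fintype.card K = (r + n) * Fintype.card K + Fintype.card K := by ring
      omega)
    have eB : K ≃ B := Fintype.equivOfCardEq (by simp [hBc])
    refine ⟨Fin.cons (fun k => (eB k : I)) Φ, ?_, ?_, ?_⟩
    · rintro ⟨a, k⟩ ⟨b, l⟩ hab
      induction a using Fin.cases with
      | zero =>
        induction b using Fin.cases with
        | zero =>
          simp only [Fin.cons_zero] at hab
          simpa using hab
        | succ b =>
          simp only [Fin.cons_zero, Fin.cons_succ] at hab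
          exact absurd (eB k).2 (by rw [hab]; exact (mem_sdiff.1 (h2 b l)).2)
      | succ a =>
        induction b using Fin.cases with
        | zero =>
          simp only [Fin.cons_zero, Fin.cons_succ] at hab
          exact absurd (eB l).2 (by rw [← hab]; exact (mem_sdiff.1 (h2 a k)).2)
        | succ b =>
          simp only [Fin.cons_succ] at hab
          have := @h1 (a, k) (b, l) hab
          simpa using this
    · intro c k
      induction c using Fin.cases with
      | zero => simpa using hBS (eB k).2
      | succ c => simpa using (mem_sdiff.1 (h2 c k)).1
    · intro c k k'
      induction c using Fin.cases with
      | zero =>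
        have a := (mem_filter.1 (hB (eB k).2)).2
        have b := (mem_filter.1 (hB (eB k').2)).2
        simp [a, b]
      | succ c => simpa using h3 c k k'

section Counting
variable {K A J : Type*} [Fintype K] [Fintype A] [Fintype J]

theorem card_filter_apply {L : Type*} [Fintype L] [DecidableEq K] (p : K) (P : L → Prop)
    [DecidablePred P] :
    #{μ : K → L | P (μ p)} * Fintype.card L =
      #{l : L | P l} * Fintype.card L ^ Fintype.card K := by
  have h : ({μ : K → L | P (μ p)} : Finset (K → L)) =
      Fintype.piFinset (fun k => if k = p then ({l : L | P l} : Finset L) else univ) := by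
    ext μ
    simp only [mem_filter, mem_univ, true_and, Fintype.mem_piFinset]
    refine ⟨fun h k => ?_, fun h => by simpa using h p⟩
    split_ifs with hk
    · simpa [hk] using h
    · exact mem_univ _
  rw [h, Fintype.card_piFinset, ← mul_prod_erase univ _ (mem_univ p), if_pos rfl,
    prod_congr rfl (g := fun _ => Fintype.card L) (fun k hk => by
      rw [if_neg (ne_of_mem_erase hk), card_univ]), prod_const, card_erase_of_mem (mem_univ p),
    card_univ, mul_assoc, ← pow_succ, Nat.sub_add_cancel (Fintype.card_pos_iff.2 ⟨p⟩)]

open Classical in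
/-- A chunk misses all blocks for at most `1 - s² / (72 |A|)` of its labellings. -/
theorem card_no_block_le (hKJ : Fintype.card K = Fintype.card J) (hJ : 0 < Fintype.card J)
    (hA : Fintype.card J ^ 2 ≤ 3 * Fintype.card A) {γ : K → A} (hγ : Function.Injective γ)
    (τ : K → J) :
    (#{μ : (K → Fin 3 × A × J) × (K → Fin 3 × A × J) × (K → Fin 3 × A × J) | ∀ p y w,
        ¬ ((μ.1 p).1 = 0 ∧ (μ.2.1 y).1 = 1 ∧ (μ.2.2 w).1 = 2 ∧ (μ.2.1 y).2.1 = γ p ∧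
          (μ.2.2 w).2.2 = τ p)} : ℝ) ≤
      (1 - (Fintype.card J : ℝ) ^ 2 / (72 * Fintype.card A)) *
        Fintype.card ((K → Fin 3 × A × J) × (K → Fin 3 × A × J) × (K → Fin 3 × A × J)) := by
  set L := Fin 3 × A × J with hL
  set s := Fintype.card J with hs
  set G := Fintype.card A with hG
  have hGpos : 0 < G := by
    rcases Nat.eq_zero_or_pos G with h | h
    · rw [h] at hA; have := pow_pos hJ 2; omega
    · exact h
  have hcL : Fintype.card L = 3 * G * s := by simp [hL, hG, hs, mul_assoc]
  have hcLr : (Fintype.card L : ℝ) = 3 * G * s := by rw [hcL]; push_cast; ring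
  have hLpos : (0 : ℝ) < Fintype.card L := by rw [hcLr]; positivity
  set M : ℝ := (Fintype.card L : ℝ) ^ s with hM
  have hMpos : 0 < M := by positivity
  have hcK : (Fintype.card (K → L) : ℝ) = M := by
    rw [Fintype.card_fun, hKJ]; push_cast; rfl
  let act (μ0 μ2 : K → L) : Finset K := {p | (μ0 p).1 = 0 ∧ ∃ w, (μ2 w).1 = 2 ∧ (μ2 w).2.2 = τ p}
  have hsplit : (#{μ : (K → L) × (K → L) × (K → L) | ∀ p y w,
        ¬ ((μ.1 p).1 = 0 ∧ (μ.2.1 y).1 = 1 ∧ (μ.2.2 w).1 = 2 ∧ (μ.2.1 y).2.1 = γ p ∧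
          (μ.2.2 w).2.2 = τ p)} : ℝ) =
      ∑ μ0 : K → L, ∑ μ2 : K → L, (#{μ1 : K → L | ∀ p y w,
        ¬ ((μ0 p).1 = 0 ∧ (μ1 y).1 = 1 ∧ (μ2 w).1 = 2 ∧ (μ1 y).2.1 = γ p ∧
          (μ2 w).2.2 = τ p)} : ℝ) := by
    simp only [card_filter, Nat.cast_sum]
    rw [Fintype.sum_prod_type]
    refine sum_congr rfl fun μ0 _ => ?_
    rw [Fintype.sum_prod_type, sum_comm]
  have hinner (μ0 μ2 : K → L) : (#{μ1 : K → L | ∀ p y w,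
        ¬ ((μ0 p).1 = 0 ∧ (μ1 y).1 = 1 ∧ (μ2 w).1 = 2 ∧ (μ1 y).2.1 = γ p ∧
          (μ2 w).2.2 = τ p)} : ℝ) ≤ M * (1 - s * #(act μ0 μ2) / (6 * G)) := by
    set a := #(act μ0 μ2) with ha
    let D : Finset (Fin 3 × A × J) := {1} ×ˢ ((act μ0 μ2).image γ ×ˢ univ)
    have hD : #D = a * s := by
      simp [D, card_image_of_injective _ hγ, ← ha, ← hs]
    have hset : ({μ1 : K → L | ∀ p y w,
        ¬ ((μ0 p).1 = 0 ∧ (μ1 y).1 = 1 ∧ (μ2 w).1 = 2 ∧ (μ1 y).2.1 = γ p ∧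
          (μ2 w).2.2 = τ p)} : Finset (K → L)) ⊆ Fintype.piFinset (fun _ => Dᶜ) := by
      intro μ1 h1
      simp only [mem_filter, mem_univ, true_and] at h1
      simp only [Fintype.mem_piFinset, mem_compl]
      intro y hy
      rw [mem_product, mem_product, mem_singleton, mem_image] at hy
      obtain ⟨hy1, ⟨p, hp, hpy⟩, -⟩ := hy
      simp only [act, mem_filter, mem_univ, true_and] at hp
      obtain ⟨hp0, w, hw, hw2⟩ := hp
      exact h1 p y w ⟨hp0, hy1, hw, hpy.symm, hw2⟩
    have has : a ≤ s := by
      rw [ha, ← hKJ]; exact card_le_univ _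
    have hcard : (#(Fintype.piFinset (fun _ : K => Dᶜ)) : ℝ) = M * (1 - a / (3 * G)) ^ s := by
      rw [Fintype.card_piFinset, prod_const, card_univ, card_compl, hD, hKJ, Nat.cast_pow,
        Nat.cast_sub (by rw [← hD]; exact card_le_univ _), hM, ← mul_pow, hcLr]
      congr 1
      push_cast
      field_simp
    have hz1 : (s : ℝ) * (a / (3 * G)) ≤ 1 := by
      rw [← mul_div_assoc, div_le_one (by positivity)]
      have h1 : (s : ℝ) ^ 2 ≤ 3 * G := by exact_mod_cast hA
      have h2 : (a : ℝ) ≤ s := by exact_mod_cast has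
      nlinarith [Nat.cast_nonneg (α := ℝ) s]
    have hz0 : (0 : ℝ) ≤ a / (3 * G) := by positivity
    have hs1 : (1 : ℝ) ≤ s := by exact_mod_cast hJ
    have hz : (1 - a / (3 * G) : ℝ) ^ s ≤ 1 - s * (a / (3 * G)) / 2 := by
      refine (one_sub_pow_le hz0 (by nlinarith) s).trans ?_
      rw [div_le_iff₀ (by positivity)]
      have : 0 ≤ (s : ℝ) * (a / (3 * G)) := by positivity
      nlinarith
    calc _ ≤ (#(Fintype.piFinset (fun _ : K => Dᶜ)) : ℝ) := by exact_mod_cast card_le_card hset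
      _ = M * (1 - a / (3 * G)) ^ s := hcard
      _ ≤ M * (1 - s * (a / (3 * G)) / 2) := by gcongr
      _ = _ := by
        congr 2
        field_simp
        ring
  have hrole (p : K) : (#{μ0 : K → L | (μ0 p).1 = 0} : ℝ) = M / 3 := by
    have h := card_filter_apply (L := L) p (fun l => l.1 = 0)
    have h2 : #{l : L | l.1 = 0} = G * s := by
      have : ({l : L | l.1 = 0} : Finset L) = ({0} : Finset (Fin 3)) ×ˢ (univ : Finset (A × J)) := by
        ext l
        rw [mem_filter, mem_product, mem_singleton]
        simp
      rw [this]
      simp [hG, hs]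
    rw [hKJ, h2] at h
    have h3 : (#{μ0 : K → L | (μ0 p).1 = 0} : ℝ) * Fintype.card L = G * s * M := by
      rw [hM]
      exact_mod_cast h
    rw [hcLr] at h3
    have : (G : ℝ) * s ≠ 0 := by positivity
    apply mul_right_cancel₀ this
    linarith
  have hhit (p : K) : M / 4 ≤ (#{μ2 : K → L | ∃ w, (μ2 w).1 = 2 ∧ (μ2 w).2.2 = τ p} : ℝ) := by
    let D : Finset (Fin 3 × A × J) := {2} ×ˢ (univ ×ˢ {τ p})
    have hD : #D = G := by simp [D, hG]
    have hset : ({μ2 : K → L | ¬ ∃ w, (μ2 w).1 = 2 ∧ (μ2 w).2.2 = τ p} : Finset (K → L)) =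
        Fintype.piFinset (fun _ => Dᶜ) := by
      ext μ
      simp only [mem_filter, mem_univ, true_and, Fintype.mem_piFinset, mem_compl, not_exists]
      refine forall_congr' fun w => not_congr ?_
      rw [mem_product, mem_product, mem_singleton, mem_singleton]
      simp
    have hsum := card_filter_add_card_filter_not (s := (univ : Finset (K → L)))
      (fun μ2 => ∃ w, (μ2 w).1 = 2 ∧ (μ2 w).2.2 = τ p)
    rw [hset, card_univ] at hsum
    have hsum' : (#{μ2 : K → L | ∃ w, (μ2 w).1 = 2 ∧ (μ2 w).2.2 = τ p} : ℝ) +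
      #(Fintype.piFinset (fun _ : K => Dᶜ)) = M := by
      rw [← hcK]; exact_mod_cast hsum
    have hcard : (#(Fintype.piFinset (fun _ : K => Dᶜ)) : ℝ) = M * (1 - 1 / (3 * s)) ^ s := by
      rw [Fintype.card_piFinset, prod_const, card_univ, card_compl, hD, hKJ, Nat.cast_pow,
        Nat.cast_sub (by rw [← hD]; exact card_le_univ _), hM, ← mul_pow, hcLr]
      congr 1
      field_simp
    have hs1 : (1 : ℝ) ≤ s := by exact_mod_cast hJ
    have hz : (1 - 1 / (3 * s) : ℝ) ^ s ≤ 3 / 4 := by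
      refine (one_sub_pow_le (by positivity) ?_ s).trans ?_
      · rw [div_le_one (by positivity)]; linarith
      · have : (s : ℝ) * (1 / (3 * s)) = 1 / 3 := by field_simp
        rw [this]; norm_num
    have := mul_le_mul_of_nonneg_left hz hMpos.le
    linarith
  have hact : s * M ^ 2 / 12 ≤ ∑ μ0 : K → L, ∑ μ2 : K → L, (#(act μ0 μ2) : ℝ) := by
    have h1 : ∑ μ0 : K → L, ∑ μ2 : K → L, (#(act μ0 μ2) : ℝ) =
        ∑ p, (#{μ0 : K → L | (μ0 p).1 = 0} : ℝ) *
          #{μ2 : K → L | ∃ w, (μ2 w).1 = 2 ∧ (μ2 w).2.2 = τ p} := by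
      simp only [act, card_filter, Nat.cast_sum, sum_mul_sum]
      rw [sum_congr rfl fun μ0 _ => sum_comm, sum_comm]
      refine sum_congr rfl fun p _ => sum_congr rfl fun μ0 _ => sum_congr rfl fun μ2 _ => ?_
      by_cases h : (μ0 p).1 = 0 <;> simp [h]
    rw [h1]
    calc (s : ℝ) * M ^ 2 / 12 = ∑ _p : K, M / 3 * (M / 4) := by
          rw [sum_const, card_univ, hKJ, nsmul_eq_mul]; ring
      _ ≤ _ := by
          refine sum_le_sum fun p _ => ?_
          rw [hrole]
          exact mul_le_mul_of_nonneg_left (hhit p) (by positivity)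
  rw [hsplit]
  calc _ ≤ ∑ μ0 : K → L, ∑ μ2 : K → L, M * (1 - s * #(act μ0 μ2) / (6 * G)) :=
        sum_le_sum fun μ0 _ => sum_le_sum fun μ2 _ => hinner μ0 μ2
    _ = M ^ 3 - M * s / (6 * G) * ∑ μ0 : K → L, ∑ μ2 : K → L, (#(act μ0 μ2) : ℝ) := by
        have (μ0 μ2 : K → L) : M * (1 - s * #(act μ0 μ2) / (6 * G)) =
          M - M * s / (6 * G) * #(act μ0 μ2) := by ring
        simp only [this, sum_sub_distrib, ← mul_sum, sum_const, card_univ, nsmul_eq_mul, hcK]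
        ring
    _ ≤ M ^ 3 - M * s / (6 * G) * (s * M ^ 2 / 12) := by gcongr
    _ = _ := by
        have hcK' : (Fintype.card (K → Fin 3 × A × J) : ℝ) = M := hcK
        simp only [Fintype.card_prod (α := K → Fin 3 × A × J), Nat.cast_mul, hcK']
        field_simp
        ring

end Counting

section Line
variable {A J : Type*} [Field A]

/-- The random slot of a position, with shift parameter `β`. -/
def slot (κ : J → A) (β : A) (x : A × J) : A := x.1 + κ x.2 * β

theorem slot_prodMk_injective (κ : J → A) (β : A) :
    Function.Injective fun x : A × J => (slot κ β x, x.2) := by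
  rintro ⟨a, k⟩ ⟨b, l⟩ h
  simp only [slot, Prod.mk.injEq] at h
  obtain ⟨h1, rfl⟩ := h
  simpa using h1

theorem eq_of_slot_eq {κ : J → A} (hκ : Function.Injective κ) {x x' : A × J} (hx : x ≠ x')
    {β β' : A} (h : slot κ β x = slot κ β x') (h' : slot κ β' x = slot κ β' x') : β = β' := by
  by_contra hne
  have h1 : (κ x.2 - κ x'.2) * (β - β') = 0 := by
    simp only [slot] at h h'
    linear_combination h - h'
  rcases mul_eq_zero.1 h1 with h2 | h2
  · have h3 := hκ (sub_eq_zero.1 h2)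
    refine hx (slot_prodMk_injective κ β ?_)
    simp [h, h3]
  · exact hne (sub_eq_zero.1 h2)

variable [Fintype A] [Fintype J]

open Classical in
theorem card_not_injective_slot_le {κ : J → A} (hκ : Function.Injective κ) {φ : J → A × J}
    (hφ : Function.Injective φ) :
    #{β : A | ¬ Function.Injective fun k => slot κ β (φ k)} ≤ Fintype.card J ^ 2 := by
  have hsub : ({β : A | ¬ Function.Injective fun k => slot κ β (φ k)} : Finset A) ⊆
      (univ : Finset (J × J)).biUnion fun x =>
        {β : A | x.1 ≠ x.2 ∧ slot κ β (φ x.1) = slot κ β (φ x.2)} := by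
    intro β hβ
    obtain ⟨-, hβ⟩ := mem_filter.1 hβ
    simp only [Function.Injective, not_forall] at hβ
    obtain ⟨k, l, h, hkl⟩ := hβ
    simp only [mem_biUnion, mem_univ, true_and, mem_filter]
    exact ⟨(k, l), hkl, h⟩
  refine (card_le_card hsub).trans ((card_biUnion_le_card_mul _ _ 1 ?_).trans ?_)
  · rintro ⟨k, l⟩ -
    refine card_le_one.2 fun β hβ β' hβ' => ?_
    simp only [mem_filter, mem_univ, true_and] at hβ hβ'
    exact eq_of_slot_eq hκ (hφ.ne hβ.1) hβ.2 hβ'.2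
  · simp [sq]

open Classical in
/-- For a fixed shift, the labellings without monochromatic block, estimated chunk by chunk. -/
theorem card_proper_labelling_le (hJ : 0 < Fintype.card J)
    (hA : Fintype.card J ^ 2 ≤ 3 * Fintype.card A) {r : ℕ} (χ : A × J → Fin r) (g : A × J → A)
    {Φ : Fin r → J ⊕ J ⊕ J → A × J}
    (hΦ : Function.Injective fun x : Fin r × (J ⊕ J ⊕ J) => Φ x.1 x.2)
    (hmono : ∀ c k k', χ (Φ c k) = χ (Φ c k')) :
    (#{lab : A × J → Fin 3 × A × J | ∀ p y w, IsBlock g Prod.snd lab p y w →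
        ¬ (χ p = χ y ∧ χ y = χ w)} : ℝ) ≤
      (∏ c, if Function.Injective fun k => g (Φ c (.inl k)) then
        (1 - (Fintype.card J : ℝ) ^ 2 / (72 * Fintype.card A)) else 1) *
        Fintype.card (A × J → Fin 3 × A × J) := by
  let L := Fin 3 × A × J
  let X := (J → L) × (J → L) × (J → L)
  let e0 : (J ⊕ J ⊕ J → L) ≃ X := (Equiv.sumArrowEquivProdArrow _ _ _).trans
    (Equiv.prodCongr (Equiv.refl _) (Equiv.sumArrowEquivProdArrow _ _ _))
  let e : (Fin r × (J ⊕ J ⊕ J) → L) ≃ (Fin r → X) :=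
    (Equiv.curry _ _ _).trans (Equiv.piCongrRight fun _ => e0)
  let N (c : Fin r) : Finset X := {μ | ∀ p y w,
    ¬ ((μ.1 p).1 = 0 ∧ (μ.2.1 y).1 = 1 ∧ (μ.2.2 w).1 = 2 ∧ (μ.2.1 y).2.1 = g (Φ c (.inl p)) ∧
      (μ.2.2 w).2.2 = (Φ c (.inl p)).2)}
  let B (c : Fin r) : Finset X :=
    if Function.Injective fun k => g (Φ c (.inl k)) then N c else univ
  let T : Set (Fin r × (J ⊕ J ⊕ J) → L) := {μ | e μ ∈ Fintype.piFinset B}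
  have hT : Nat.card T = ∏ c, #(B c) := by
    have e1 : T ≃ {x // x ∈ Fintype.piFinset B} := e.subtypeEquiv fun μ => Iff.rfl
    rw [Nat.card_congr e1, Nat.card_eq_fintype_card, Fintype.card_coe, Fintype.card_piFinset]
  set Ψ : Fin r × (J ⊕ J ⊕ J) → A × J := fun x => Φ x.1 x.2 with hΨ
  have hle : #{lab : A × J → Fin 3 × A × J | ∀ p y w, IsBlock g Prod.snd lab p y w →
        ¬ (χ p = χ y ∧ χ y = χ w)} ≤ Nat.card {lab : A × J → L // lab ∘ Ψ ∈ T} := by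
    rw [Nat.card_eq_fintype_card, Fintype.card_subtype]
    refine card_le_card fun lab hlab => ?_
    simp only [mem_filter, mem_univ, true_and] at hlab ⊢
    change e (lab ∘ Ψ) ∈ Fintype.piFinset B
    rw [Fintype.mem_piFinset]
    intro c
    by_cases hc : Function.Injective fun k => g (Φ c (.inl k))
    · simp only [B, if_pos hc, N, mem_filter, mem_univ, true_and]
      intro p y w h
      exact hlab (Φ c (.inl p)) (Φ c (.inr (.inl y))) (Φ c (.inr (.inr w))) h
        ⟨hmono c _ _, hmono c _ _⟩
    · simp only [B, if_neg hc]; exact mem_univ _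
  have hB (c : Fin r) : (#(B c) : ℝ) ≤ (if Function.Injective fun k => g (Φ c (.inl k)) then
        (1 - (Fintype.card J : ℝ) ^ 2 / (72 * Fintype.card A)) else 1) * Fintype.card X := by
    by_cases hc : Function.Injective fun k => g (Φ c (.inl k))
    · simp only [B, if_pos hc]
      exact card_no_block_le rfl hJ hA hc (fun k => (Φ c (.inl k)).2)
    · simp only [B, if_neg hc, one_mul, card_univ, le_refl]
  have hX : (∏ _c : Fin r, (Fintype.card X : ℝ)) =
      (Fintype.card L : ℝ) ^ Fintype.card (Fin r × (J ⊕ J ⊕ J)) := by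
    have h1 : Fintype.card (Fin r → X) = Fintype.card (Fin r × (J ⊕ J ⊕ J) → L) :=
      Fintype.card_congr e.symm
    rw [Fintype.card_fun, Fintype.card_fun, Fintype.card_fin] at h1
    rw [prod_const, card_univ, Fintype.card_fin]
    exact_mod_cast h1
  have hcomp := card_comp_mem (L := L) hΦ T
  rw [hT] at hcomp
  have hcomp' : (Nat.card {lab : A × J → L // lab ∘ Ψ ∈ T} : ℝ) *
      (Fintype.card L : ℝ) ^ Fintype.card (Fin r × (J ⊕ J ⊕ J)) =
      (∏ c, (#(B c) : ℝ)) * Fintype.card (A × J → L) := by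
    rw [Fintype.card_fun (β := L)]
    exact_mod_cast hcomp
  have hprod := prod_le_prod (s := univ) (fun c _ => Nat.cast_nonneg (α := ℝ) #(B c))
    (fun c _ => hB c)
  rw [prod_mul_distrib, hX] at hprod
  have hLpos : (0 : ℝ) < (Fintype.card L : ℝ) ^ Fintype.card (Fin r × (J ⊕ J ⊕ J)) := by
    have : Nonempty J := Fintype.card_pos_iff.1 hJ
    have : 0 < Fintype.card L := Fintype.card_pos
    positivity
  refine (Nat.cast_le (α := ℝ).2 hle).trans (le_of_mul_le_mul_right ?_ hLpos)
  rw [hcomp']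
  calc _ ≤ _ := mul_le_mul_of_nonneg_right hprod (Nat.cast_nonneg _)
    _ = _ := by ring

open Classical in
/-- A fixed colouring of a line is rarely proper for the random blocks on it. -/
theorem card_proper_le {κ : J → A} (hκ : Function.Injective κ) (hJ : 0 < Fintype.card J)
    (hA : Fintype.card J ^ 2 ≤ 3 * Fintype.card A) {r : ℕ} (hr : 0 < r)
    (hG : 6 * r ≤ Fintype.card A) (χ : A × J → Fin r) :
    (#{ω : A × (A × J → Fin 3 × A × J) | ∀ p y w,
        IsBlock (slot κ ω.1) Prod.snd ω.2 p y w → ¬ (χ p = χ y ∧ χ y = χ w)} : ℝ) ≤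
      (2 * (Fintype.card J : ℝ) ^ 2 / Fintype.card A +
        Real.exp (-((Fintype.card J : ℝ) ^ 2 * r / (144 * Fintype.card A)))) *
        Fintype.card (A × (A × J → Fin 3 × A × J)) := by
  obtain ⟨Φ, hΦ, -, hmono⟩ := exists_monochromatic_chunks (K := J ⊕ J ⊕ J) χ r univ (by
    rw [card_univ, Fintype.card_prod, Fintype.card_sum, Fintype.card_sum]
    nlinarith)
  set s := Fintype.card J with hs
  set G := Fintype.card A with hGd
  have hGpos : 0 < G := Fintype.card_pos
  set δ : ℝ := (s : ℝ) ^ 2 / (72 * G) with hδ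
  have hδ1 : δ ≤ 1 := by
    rw [hδ, div_le_one (by positivity)]
    have : (s : ℝ) ^ 2 ≤ 3 * G := by exact_mod_cast hA
    have : (0 : ℝ) ≤ G := Nat.cast_nonneg _
    linarith
  have hδ0 : 0 ≤ δ := by positivity
  let bad (β : A) : Finset (Fin r) :=
    {c | ¬ Function.Injective fun k => slot κ β (Φ c (.inl k))}
  have hprod (β : A) : (∏ c, if Function.Injective fun k => slot κ β (Φ c (.inl k)) then
      (1 - δ) else 1) ≤ Real.exp (-(δ * r / 2)) + 2 * #(bad β) / r := by
    rw [prod_ite, prod_const, prod_const_one, mul_one]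
    set m := #{c | Function.Injective fun k => slot κ β (Φ c (.inl k))} with hm
    have hsum : m + #(bad β) = r := by
      have := card_filter_add_card_filter_not (s := (univ : Finset (Fin r)))
        (fun c => Function.Injective fun k => slot κ β (Φ c (.inl k)))
      rwa [card_univ, Fintype.card_fin] at this
    have hsum' : (m : ℝ) + #(bad β) = r := by exact_mod_cast hsum
    have hr' : (0 : ℝ) < r := by exact_mod_cast hr
    rcases le_total ((r : ℝ)) (2 * #(bad β)) with h | h
    · have h1 : (1 - δ) ^ m ≤ 1 := pow_le_one₀ (by linarith) (by linarith)
      have h2 : 1 ≤ 2 * (#(bad β) : ℝ) / r := by rwa [le_div_iff₀ hr', one_mul]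
      have := Real.exp_pos (-(δ * r / 2))
      linarith
    · have h1 : (1 - δ) ^ m ≤ Real.exp (-(δ * r / 2)) := by
        calc (1 - δ) ^ m ≤ Real.exp (-δ) ^ m :=
              pow_le_pow_left₀ (by linarith) (Real.one_sub_le_exp_neg δ) m
          _ = Real.exp (m * -δ) := (Real.exp_nat_mul _ _).symm
          _ ≤ _ := by
            apply Real.exp_le_exp.2
            have : (r : ℝ) / 2 ≤ m := by linarith
            nlinarith
      have h2 : 0 ≤ 2 * (#(bad β) : ℝ) / r := by positivity
      linarith
  have hbad : ∑ β, #(bad β) ≤ r * s ^ 2 := by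
    calc ∑ β, #(bad β) = ∑ c, #{β : A | ¬ Function.Injective fun k => slot κ β (Φ c (.inl k))} := by
          simp only [bad, card_filter]
          exact sum_comm
      _ ≤ ∑ _c : Fin r, s ^ 2 := by
          refine sum_le_sum fun c _ => card_not_injective_slot_le hκ fun k l hkl => ?_
          have := @hΦ (c, .inl k) (c, .inl l) hkl
          simpa using this
      _ = _ := by simp
  have hbad' : ∑ β, (#(bad β) : ℝ) ≤ r * s ^ 2 := by exact_mod_cast hbad
  set W : ℝ := ((Fintype.card (A × J → Fin 3 × A × J) : ℕ) : ℝ) with hW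
  have hsplit : (#{ω : A × (A × J → Fin 3 × A × J) | ∀ p y w,
        IsBlock (slot κ ω.1) Prod.snd ω.2 p y w → ¬ (χ p = χ y ∧ χ y = χ w)} : ℝ) =
      ∑ β, (#{lab : A × J → Fin 3 × A × J | ∀ p y w,
        IsBlock (slot κ β) Prod.snd lab p y w → ¬ (χ p = χ y ∧ χ y = χ w)} : ℝ) := by
    simp only [card_filter, Nat.cast_sum]
    rw [Fintype.sum_prod_type]
  rw [hsplit]
  have hr' : (0 : ℝ) < r := by exact_mod_cast hr
  calc _ ≤ ∑ β : A, (Real.exp (-(δ * r / 2)) + 2 * #(bad β) / r) * W := by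
        refine sum_le_sum fun β _ => ?_
        refine (card_proper_labelling_le hJ hA χ (slot κ β) hΦ hmono).trans ?_
        exact mul_le_mul_of_nonneg_right (hprod β) (Nat.cast_nonneg _)
    _ = (G * Real.exp (-(δ * r / 2)) + 2 / r * ∑ β, (#(bad β) : ℝ)) * W := by
        rw [← sum_mul, sum_add_distrib, sum_const, card_univ, nsmul_eq_mul, mul_sum]
        congr 2
        exact sum_congr rfl fun _ _ => by ring
    _ ≤ (G * Real.exp (-(δ * r / 2)) + 2 / r * (r * s ^ 2)) * W := by
        gcongr
    _ = _ := by
        have h1 : δ * r / 2 = (s : ℝ) ^ 2 * r / (144 * G) := by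
          rw [hδ]; field_simp; norm_num
        have h2 : (Fintype.card (A × (A × J → Fin 3 × A × J)) : ℝ) = G * W := by
          rw [Fintype.card_prod, Nat.cast_mul]
        rw [h1, h2]
        field_simp
        ring

end Line

section Geometry
variable {I F : Type*} [Field F]

/-- The point above `i` of the line with parameters `l = (t, b, c)`. -/
def point (ι : I → F) (l : F × F × F) (i : I) : I × F × F :=
  (i, l.2.1 + ι i * l.1, l.2.2 + ι i * l.1 ^ 2)

theorem point_injective (ι : I → F) (l : F × F × F) : Function.Injective (point ι l) :=
  fun _ _ h => congrArg Prod.fst h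

/-- The lines contain no proper triangle. -/
theorem eq_of_point_eq {ι : I → F} (hι : Function.Injective ι) {x y z : I} (hxy : x ≠ y)
    (hyz : y ≠ z) (hzx : z ≠ x) {k l m : F × F × F} (hy : point ι k y = point ι l y)
    (hz : point ι l z = point ι m z) (hx : point ι m x = point ι k x) : k = l ∧ l = m := by
  obtain ⟨t, b, c⟩ := k
  obtain ⟨t', b', c'⟩ := l
  obtain ⟨t'', b'', c''⟩ := m
  simp only [point, Prod.mk.injEq, true_and] at hx hy hz
  obtain ⟨hx1, hx2⟩ := hx
  obtain ⟨hy1, hy2⟩ := hy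
  obtain ⟨hz1, hz2⟩ := hz
  have hα : ι y - ι x ≠ 0 := sub_ne_zero.2 fun h => hxy (hι h.symm)
  have hβ : ι z - ι y ≠ 0 := sub_ne_zero.2 fun h => hyz (hι h.symm)
  have hγ : ι z - ι x ≠ 0 := sub_ne_zero.2 fun h => hzx (hι h)
  have e1 : (ι y - ι x) * (t - t'') + (ι z - ι y) * (t' - t'') = 0 := by
    linear_combination hx1 + hy1 + hz1
  have e2 : (ι y - ι x) * (t ^ 2 - t'' ^ 2) + (ι z - ι y) * (t' ^ 2 - t'' ^ 2) = 0 := by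
    linear_combination hx2 + hy2 + hz2
  have e3 : (ι y - ι x) * (ι z - ι x) * (t - t'') ^ 2 = 0 := by
    linear_combination (ι z - ι y) * (e2 - 2 * t'' * e1) -
      ((ι z - ι y) * (t' - t'') - (ι y - ι x) * (t - t'')) * e1
  have ht : t = t'' := by
    have := (mul_eq_zero.1 e3).resolve_left (mul_ne_zero hα hγ)
    exact sub_eq_zero.1 (pow_eq_zero_iff two_ne_zero |>.1 this)
  subst ht
  have ht' : t' = t := by
    rw [sub_self, mul_zero, zero_add] at e1
    exact sub_eq_zero.1 ((mul_eq_zero.1 e1).resolve_left hβ)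
  subst ht'
  simp only [add_left_inj] at hx1 hx2 hy1 hy2
  simp [hx1, hx2, ← hy1, ← hy2]

end Geometry

/-- Union bound over all colourings, for independent uniform choices `ω l`. -/
theorem exists_forall_exists_notMem {V Λ Ω : Type*} [Fintype V] [Fintype Λ] [Fintype Ω]
    [Nonempty Ω] {r : ℕ} {ρ : ℝ} (P : (V → Fin r) → Λ → Finset Ω)
    (hP : ∀ c l, (#(P c l) : ℝ) ≤ ρ * Fintype.card Ω)
    (h : (r : ℝ) ^ Fintype.card V * ρ ^ Fintype.card Λ < 1) :
    ∃ ω : Λ → Ω, ∀ c, ∃ l, ω l ∉ P c l := by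
  classical
  by_contra! hcon
  have hcover : (univ : Finset (Λ → Ω)) ⊆
      (univ : Finset (V → Fin r)).biUnion fun c => Fintype.piFinset (P c) := by
    intro ω _
    obtain ⟨c, hc⟩ := hcon ω
    simp only [mem_biUnion, mem_univ, true_and, Fintype.mem_piFinset]
    exact ⟨c, hc⟩
  have hcard := (card_le_card hcover).trans card_biUnion_le
  rw [card_univ, Fintype.card_fun] at hcard
  have hcard' : (Fintype.card Ω : ℝ) ^ Fintype.card Λ ≤
      ∑ c : V → Fin r, (#(Fintype.piFinset (P c)) : ℝ) := by exact_mod_cast hcard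
  have hle : ∀ c : V → Fin r, (#(Fintype.piFinset (P c)) : ℝ) ≤
      (ρ * Fintype.card Ω) ^ Fintype.card Λ := by
    intro c
    rw [Fintype.card_piFinset, Nat.cast_prod]
    calc _ ≤ ∏ _l : Λ, ρ * (Fintype.card Ω : ℝ) :=
          prod_le_prod (fun _ _ => Nat.cast_nonneg _) fun l _ => hP c l
      _ = _ := by rw [prod_const, card_univ]
  have hsum := hcard'.trans (sum_le_sum fun c _ => hle c)
  rw [sum_const, card_univ, Fintype.card_fun, Fintype.card_fin, nsmul_eq_mul, Nat.cast_pow,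
    mul_pow, ← mul_assoc] at hsum
  have hpos : (0 : ℝ) < (Fintype.card Ω : ℝ) ^ Fintype.card Λ := by
    have : 0 < Fintype.card Ω := Fintype.card_pos
    positivity
  nlinarith

section Construction
variable {A J F : Type*} [Field A] [Field F] [Fintype A] [Fintype J] [Fintype F]

open Classical in
/-- The indices of the edges: a line together with a block of it. -/
noncomputable def blocks (κ : J → A) (ω : F × F × F → A × (A × J → Fin 3 × A × J)) :
    Finset ((F × F × F) × (A × J) × (A × J) × (A × J)) :=
  {x | IsBlock (slot κ (ω x.1).1) Prod.snd (ω x.1).2 x.2.1 x.2.2.1 x.2.2.2}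

open Classical in
/-- The edges of the random 3-graph. -/
noncomputable def edgeSet (κ : J → A) (ι : A × J → F)
    (ω : F × F × F → A × (A × J → Fin 3 × A × J)) : Finset (Finset ((A × J) × F × F)) :=
  (blocks κ ω).image fun x =>
    {point ι x.1 x.2.1, point ι x.1 x.2.2.1, point ι x.1 x.2.2.2}

open Classical in
theorem mem_edgeSet {κ : J → A} {ι : A × J → F}
    {ω : F × F × F → A × (A × J → Fin 3 × A × J)} {e : Finset ((A × J) × F × F)} :
    e ∈ edgeSet κ ι ω ↔ ∃ l p y w, IsBlock (slot κ (ω l).1) Prod.snd (ω l).2 p y w ∧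
      {point ι l p, point ι l y, point ι l w} = e := by
  simp [edgeSet, blocks]

theorem card_edgeSet_le (κ : J → A) (ι : A × J → F)
    (ω : F × F × F → A × (A × J → Fin 3 × A × J)) :
    #(edgeSet κ ι ω) ≤ Fintype.card F ^ 3 * (Fintype.card A * Fintype.card J) ^ 2 := by
  classical
  have h1 : #(blocks κ ω) ≤ #(univ : Finset ((F × F × F) × (A × J) × (A × J))) := by
    refine card_le_card_of_injOn (fun x => (x.1, x.2.2.1, x.2.2.2)) (fun _ _ => mem_univ _) ?_
    rintro ⟨l, p, y, w⟩ h ⟨l', p', y', w'⟩ h' heq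
    simp only [Prod.mk.injEq] at heq
    obtain ⟨rfl, rfl, rfl⟩ := heq
    simp only [blocks, coe_filter, mem_univ, true_and, Set.mem_ofPred_eq] at h h'
    have : p = p' := slot_prodMk_injective κ (ω l).1 (by
      simp only [← h.2.2.2.1, ← h.2.2.2.2, ← h'.2.2.2.1, ← h'.2.2.2.2])
    rw [this]
  refine card_image_le.trans (h1.trans (le_of_eq ?_))
  rw [card_univ]
  simp only [Fintype.card_prod]
  ring

theorem card_of_mem_edgeSet {κ : J → A} {ι : A × J → F}
    {ω : F × F × F → A × (A × J → Fin 3 × A × J)} {e : Finset ((A × J) × F × F)}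
    (he : e ∈ edgeSet κ ι ω) : #e = 3 := by
  classical
  obtain ⟨l, p, y, w, ⟨hp, hy, hw, -⟩, rfl⟩ := mem_edgeSet.1 he
  have hinj := point_injective ι l
  refine card_eq_three.2 ⟨_, _, _, hinj.ne ?_, hinj.ne ?_, hinj.ne ?_, by congr⟩ <;> rintro rfl
  · simp [hp] at hy
  · simp [hp] at hw
  · simp [hy] at hw

open Classical in
theorem edgeSet_no_triangle (κ : J → A) {ι : A × J → F} (hι : Function.Injective ι)
    (ω : F × F × F → A × (A × J → Fin 3 × A × J)) {v : Fin 6 → (A × J) × F × F}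
    (hv : Function.Injective v) (h0 : {v 0, v 1, v 2} ∈ edgeSet κ ι ω)
    (h1 : {v 2, v 3, v 4} ∈ edgeSet κ ι ω) (h2 : {v 4, v 5, v 0} ∈ edgeSet κ ι ω) : False := by
  obtain ⟨l, p, y, w, hb, he⟩ := mem_edgeSet.1 h0
  obtain ⟨l', p', y', w', hb', he'⟩ := mem_edgeSet.1 h1
  obtain ⟨l'', p'', y'', w'', hb'', he''⟩ := mem_edgeSet.1 h2
  have key : ∀ {m : F × F × F} {a b c : A × J} {x : (A × J) × F × F},
      x ∈ ({point ι m a, point ι m b, point ι m c} : Finset _) → x = point ι m x.1 := by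
    intro m a b c x hx
    simp only [mem_insert, mem_singleton] at hx
    rcases hx with rfl | rfl | rfl <;> rfl
  have k0 : v 0 = point ι l (v 0).1 := key (by rw [he]; simp)
  have k1 : v 1 = point ι l (v 1).1 := key (by rw [he]; simp)
  have k2 : v 2 = point ι l (v 2).1 := key (by rw [he]; simp)
  have k2' : v 2 = point ι l' (v 2).1 := key (by rw [he']; simp)
  have k3 : v 3 = point ι l' (v 3).1 := key (by rw [he']; simp)
  have k4 : v 4 = point ι l' (v 4).1 := key (by rw [he']; simp)
  have k4' : v 4 = point ι l'' (v 4).1 := key (by rw [he'']; simp)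
  have k5 : v 5 = point ι l'' (v 5).1 := key (by rw [he'']; simp)
  have k0' : v 0 = point ι l'' (v 0).1 := key (by rw [he'']; simp)
  have n02 : (v 0).1 ≠ (v 2).1 := fun h =>
    hv.ne (show (0 : Fin 6) ≠ 2 by decide) (by rw [k0, k2, h])
  have n24 : (v 2).1 ≠ (v 4).1 := fun h =>
    hv.ne (show (2 : Fin 6) ≠ 4 by decide) (by rw [k2', k4, h])
  have n40 : (v 4).1 ≠ (v 0).1 := fun h =>
    hv.ne (show (4 : Fin 6) ≠ 0 by decide) (by rw [k4', k0', h])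
  obtain ⟨rfl, rfl⟩ := eq_of_point_eq hι n02 n24 n40 (k2.symm.trans k2') (k4.symm.trans k4')
    (k0'.symm.trans k0)
  have hall : ∀ i, v i = point ι l (v i).1 := by
    intro i
    fin_cases i <;> assumption
  have hinj : Function.Injective fun i => (v i).1 := fun i j hij => hv (by
    rw [hall i, hall j]
    exact congrArg _ hij)
  refine IsBlock.no_triangle (slot_prodMk_injective κ (ω l).1) hinj (p := ![p, p', p''])
    (y := ![y, y', y'']) (w := ![w, w', w'']) (lab := (ω l).2) ?_ ?_ ?_ ?_
  · intro i
    fin_cases i <;> assumption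
  · simpa [image_insert, point] using congrArg (image Prod.fst) he.symm
  · simpa [image_insert, point] using congrArg (image Prod.fst) he'.symm
  · simpa [image_insert, point] using congrArg (image Prod.fst) he''.symm

open Classical in
theorem exists_edgeSet_not_proper {κ : J → A} (hκ : Function.Injective κ) (ι : A × J → F)
    (hJ : 0 < Fintype.card J) (hA : Fintype.card J ^ 2 ≤ 3 * Fintype.card A) {r : ℕ}
    (hr : 0 < r) (hG : 6 * r ≤ Fintype.card A) {ρ : ℝ}
    (hρ : 2 * (Fintype.card J : ℝ) ^ 2 / Fintype.card A +
        Real.exp (-((Fintype.card J : ℝ) ^ 2 * r / (144 * Fintype.card A))) ≤ ρ)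
    (h : (r : ℝ) ^ (Fintype.card A * Fintype.card J * Fintype.card F ^ 2) *
      ρ ^ Fintype.card F ^ 3 < 1) :
    ∃ ω : F × F × F → A × (A × J → Fin 3 × A × J), ∀ c : (A × J) × F × F → Fin r,
      ∃ e ∈ edgeSet κ ι ω, ∀ u ∈ e, ∀ v ∈ e, c u = c v := by
  have : Nonempty J := Fintype.card_pos_iff.1 hJ
  obtain ⟨ω, hω⟩ := exists_forall_exists_notMem (V := (A × J) × F × F) (Λ := F × F × F) (r := r)
    (Ω := A × (A × J → Fin 3 × A × J))
    (fun c l => {ω | ∀ p y w, IsBlock (slot κ ω.1) Prod.snd ω.2 p y w →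
      ¬ (c (point ι l p) = c (point ι l y) ∧ c (point ι l y) = c (point ι l w))})
    (fun c l => (card_proper_le hκ hJ hA hr hG fun i => c (point ι l i)).trans
      (mul_le_mul_of_nonneg_right hρ (Nat.cast_nonneg _)))
    (by
      convert h using 3
      · simp only [Fintype.card_prod]; ring
      · simp only [Fintype.card_prod]; ring)
  refine ⟨ω, fun c => ?_⟩
  obtain ⟨l, hl⟩ := hω c
  simp only [mem_filter, mem_univ, true_and, not_forall, not_not] at hl
  obtain ⟨p, y, w, hb, h1, h2⟩ := hl
  refine ⟨_, mem_edgeSet.2 ⟨l, p, y, w, hb, rfl⟩, ?_⟩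
  simp only [mem_insert, mem_singleton]
  rintro u (rfl | rfl | rfl) v (rfl | rfl | rfl) <;> simp [h1, h2]

end Construction

theorem exists_threeGraph {V : Type*} [Fintype V] [DecidableEq V] {r : ℕ} (E : Finset (Finset V))
    (hcard : ∀ e ∈ E, #e = 3)
    (hfree : ∀ v : Fin 6 → V, Function.Injective v → {v 0, v 1, v 2} ∈ E → {v 2, v 3, v 4} ∈ E →
      {v 4, v 5, v 0} ∈ E → False)
    (hcol : ∀ c : V → Fin r, ∃ e ∈ E, ∀ u ∈ e, ∀ v ∈ e, c u = c v) :
    ∃ G : ThreeGraph, G.Free looseC3 ∧ ¬ G.Colorable r ∧ #G.edges ≤ #E := by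
  let φ := Fintype.equivFin V
  refine ⟨⟨Fintype.card V, E.image fun e => e.image φ, ?_⟩, ?_, ?_, card_image_le⟩
  · intro e he
    obtain ⟨e', he', rfl⟩ := mem_image.1 he
    rw [card_image_of_injective _ φ.injective, hcard e' he']
  · rintro ⟨f, hf⟩
    let g : Fin 6 ↪ Fin (Fintype.card V) := f
    have hg : ∀ e ∈ ({{0, 1, 2}, {2, 3, 4}, {4, 5, 0}} : Finset (Finset (Fin 6))),
        e.image g ∈ E.image fun e => e.image φ := hf
    have back : ∀ a b c : Fin 6,
        {a, b, c} ∈ ({{0, 1, 2}, {2, 3, 4}, {4, 5, 0}} : Finset (Finset (Fin 6))) →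
        {φ.symm (g a), φ.symm (g b), φ.symm (g c)} ∈ E := by
      intro a b c habc
      obtain ⟨e, he, heq⟩ := mem_image.1 (hg _ habc)
      have h := congrArg (image φ.symm) heq
      simp only [image_image, Equiv.symm_comp_self, image_id] at h
      rw [h] at he
      simpa [image_insert] using he
    exact hfree (fun i => φ.symm (g i)) (φ.symm.injective.comp g.injective)
      (back 0 1 2 (by decide)) (back 2 3 4 (by decide)) (back 4 5 0 (by decide))
  · rintro ⟨c, hc⟩
    obtain ⟨e, he, hmono⟩ := hcol (c ∘ φ)
    obtain ⟨u, hu, v, hv, hne⟩ := hc _ (mem_image_of_mem _ he)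
    obtain ⟨u', hu', rfl⟩ := mem_image.1 hu
    obtain ⟨v', hv', rfl⟩ := mem_image.1 hv
    exact hne (hmono u' hu' v' hv')

theorem exists_threeGraph_of_log_le {r s : ℕ} (hs : 2 ≤ s) (hsr : s ^ 4 < r)
    (hlog : 1728 * Real.log r ≤ (s : ℝ) ^ 2) :
    ∃ G : ThreeGraph, G.Free looseC3 ∧ ¬ G.Colorable r ∧ #G.edges ≤ 64 * (12 * r * s) ^ 5 := by
  have hr : 0 < r := by omega
  have hs2 : s ^ 2 ≤ s ^ 4 := Nat.pow_le_pow_right (by omega) (by norm_num)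
  have hs1 : s ≤ s ^ 4 := Nat.le_self_pow (by norm_num) s
  obtain ⟨G, hGp, hG1, hG2⟩ := Nat.exists_prime_lt_and_le_two_mul (6 * r) (by omega)
  have hGs : 0 < G * s := Nat.mul_pos hGp.pos (by omega)
  obtain ⟨q, hqp, hq1, hq2⟩ := Nat.exists_prime_lt_and_le_two_mul (2 * (G * s)) (by omega)
  have := Fact.mk hGp
  have := Fact.mk hqp
  obtain ⟨κ⟩ := Function.Embedding.nonempty_of_card_le (α := Fin s) (β := ZMod G) (by
    rw [Fintype.card_fin, ZMod.card]; omega)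
  obtain ⟨ι⟩ := Function.Embedding.nonempty_of_card_le (α := ZMod G × Fin s) (β := ZMod q) (by
    rw [Fintype.card_prod, Fintype.card_fin, ZMod.card, ZMod.card]; omega)
  have hr' : (0 : ℝ) < r := by exact_mod_cast hr
  have hs' : (2 : ℝ) ≤ s := by exact_mod_cast hs
  have hG' : (0 : ℝ) < G := by exact_mod_cast hGp.pos
  have hG1' : 6 * (r : ℝ) ≤ G := by exact_mod_cast hG1.le
  have hG2' : (G : ℝ) ≤ 12 * r := by exact_mod_cast hG2.trans_eq (by ring)
  have hsr' : (s : ℝ) ^ 4 < r := by exact_mod_cast hsr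
  have hsr2 : (s : ℝ) ^ 2 ≤ r := by exact_mod_cast hs2.trans hsr.le
  set ρ : ℝ := (s : ℝ) ^ 2 / r with hρ
  have hρ0 : 0 ≤ ρ := by positivity
  have hρ1 : ρ ≤ 1 := by rwa [hρ, div_le_one hr']
  have hρr : r * ρ ^ 2 < 1 := by
    have : r * ρ ^ 2 = (s : ℝ) ^ 4 / r := by rw [hρ]; field_simp
    rwa [this, div_lt_one hr']
  have hexp : Real.exp (-((s : ℝ) ^ 2 * r / (144 * G))) ≤ 1 / r := by
    rw [one_div, ← Real.exp_log hr', ← Real.exp_neg, Real.exp_log hr']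
    apply Real.exp_le_exp.2
    rw [neg_le_neg_iff, le_div_iff₀ (by positivity)]
    have hlog0 : 0 ≤ Real.log r := Real.log_natCast_nonneg r
    calc Real.log r * (144 * G) ≤ Real.log r * (144 * (12 * r)) := by gcongr
      _ = 1728 * Real.log r * r := by ring
      _ ≤ _ := by gcongr
  have hρ2 : 2 * (s : ℝ) ^ 2 / G + Real.exp (-((s : ℝ) ^ 2 * r / (144 * G))) ≤ ρ := by
    have h1 : 2 * (s : ℝ) ^ 2 / G ≤ 2 * (s : ℝ) ^ 2 / (6 * r) := by gcongr
    have h2 : 2 * (s : ℝ) ^ 2 / (6 * r) + 1 / r = ((s : ℝ) ^ 2 / 3 + 1) / r := by field_simp; ring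
    have h3 : ((s : ℝ) ^ 2 / 3 + 1) / r ≤ ρ := by
      rw [hρ]
      gcongr
      nlinarith
    linarith
  have hunion : (r : ℝ) ^ (G * s * q ^ 2) * ρ ^ q ^ 3 < 1 := by
    have h1 : 2 * (G * s * q ^ 2) ≤ q ^ 3 := by nlinarith [sq_nonneg q]
    calc (r : ℝ) ^ (G * s * q ^ 2) * ρ ^ q ^ 3
        ≤ (r : ℝ) ^ (G * s * q ^ 2) * ρ ^ (2 * (G * s * q ^ 2)) := by
          gcongr ?_ * ?_
          exact pow_le_pow_of_le_one hρ0 hρ1 h1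
      _ = (r * ρ ^ 2) ^ (G * s * q ^ 2) := by rw [mul_pow, pow_mul ρ]
      _ < 1 := pow_lt_one₀ (by positivity) hρr
          (Nat.mul_pos hGs (pow_pos hqp.pos 2)).ne'
  obtain ⟨ω, hω⟩ := exists_edgeSet_not_proper (A := ZMod G) (J := Fin s) (F := ZMod q) (r := r)
    (ρ := ρ) κ.injective ι (by rw [Fintype.card_fin]; omega)
    (by rw [Fintype.card_fin, ZMod.card]; omega) hr (by rw [ZMod.card]; exact hG1.le)
    (by rwa [Fintype.card_fin, ZMod.card]) (by rwa [Fintype.card_fin, ZMod.card, ZMod.card])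
  classical
  obtain ⟨H, hH1, hH2, hH3⟩ := exists_threeGraph (edgeSet κ ι ω)
    (fun e he => card_of_mem_edgeSet he)
    (fun v hv h0 h1 h2 => edgeSet_no_triangle κ ι.injective ω hv (by convert h0) (by convert h1)
      (by convert h2)) hω
  refine ⟨H, hH1, hH2, hH3.trans ((card_edgeSet_le κ ι ω).trans ?_)⟩
  rw [Fintype.card_fin, ZMod.card, ZMod.card]
  have hG3 : G * s ≤ 12 * r * s := Nat.mul_le_mul_right s (by omega)
  calc q ^ 3 * (G * s) ^ 2 ≤ (4 * (G * s)) ^ 3 * (G * s) ^ 2 := by gcongr; omega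
    _ = 64 * (G * s) ^ 5 := by ring
    _ ≤ _ := by gcongr

theorem _root_.ThreeGraph.Colorable.mono {G : ThreeGraph} {r r' : ℕ} (h : r ≤ r')
    (hG : G.Colorable r) : G.Colorable r' := by
  obtain ⟨c, hc⟩ := hG
  refine ⟨Fin.castLE h ∘ c, fun e he => ?_⟩
  obtain ⟨u, hu, v, hv, hne⟩ := hc e he
  exact ⟨u, hu, v, hv, fun h' => hne (Fin.castLE_injective h h')⟩

theorem exists_threeGraph_of_large : ∃ r₀ : ℕ, ∀ r : ℕ, r₀ ≤ r →
    ∃ G : ThreeGraph, G.Free looseC3 ∧ ¬ G.Colorable r ∧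
      (#G.edges : ℝ) ≤ 64 * 516 ^ 5 * (r : ℝ) ^ 5 * Real.log r ^ ((5 : ℝ) / 2) := by
  have hlim : Filter.Tendsto (fun r : ℕ => Real.log r) Filter.atTop Filter.atTop :=
    Real.tendsto_log_atTop.comp tendsto_natCast_atTop_atTop
  have hlittle : ∀ᶠ r : ℕ in Filter.atTop, 43 ^ 4 * Real.log r ^ 2 < r := by
    have h1 := (isLittleO_log_rpow_atTop (show (0 : ℝ) < 1 / 2 by norm_num)).def
      (show (0 : ℝ) < 1 / 43 ^ 3 by norm_num)
    filter_upwards [tendsto_natCast_atTop_atTop.eventually h1, hlim.eventually_ge_atTop 1,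
      Filter.eventually_gt_atTop 0] with r h hl hr
    have hr' : (0 : ℝ) < r := by exact_mod_cast hr
    rw [Real.norm_of_nonneg (by linarith), Real.norm_of_nonneg (by positivity),
      ← Real.sqrt_eq_rpow] at h
    have h2 : Real.log r ^ 2 ≤ (1 / 43 ^ 3 * √r) ^ 2 := by gcongr
    rw [mul_pow, Real.sq_sqrt hr'.le] at h2
    linarith
  obtain ⟨r₀, hr₀⟩ := Filter.eventually_atTop.1 (hlittle.and (hlim.eventually_ge_atTop 1))
  refine ⟨r₀, fun r hr => ?_⟩
  obtain ⟨hsmall, hl⟩ := hr₀ r hr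
  set x : ℝ := √(Real.log r) with hx
  have hx1 : 1 ≤ x := Real.one_le_sqrt.2 hl
  have hx2 : x ^ 2 = Real.log r := Real.sq_sqrt (by linarith)
  set s : ℕ := ⌈42 * x⌉₊ with hs
  have hs1 : 42 * x ≤ s := Nat.le_ceil _
  have hs2 : (s : ℝ) ≤ 43 * x := by
    have := Nat.ceil_lt_add_one (show 0 ≤ 42 * x by linarith)
    linarith
  have hs3 : 2 ≤ s := by
    have : (2 : ℝ) ≤ s := by linarith
    exact_mod_cast this
  obtain ⟨G, h1, h2, h3⟩ := exists_threeGraph_of_log_le (r := r) hs3 (by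
    have : (s : ℝ) ^ 4 ≤ (43 * x) ^ 4 := by gcongr
    have h4 : (43 * x) ^ 4 = 43 ^ 4 * Real.log r ^ 2 := by rw [← hx2]; ring
    have : (s : ℝ) ^ 4 < r := by linarith
    exact_mod_cast this) (by
    have : (42 * x) ^ 2 ≤ (s : ℝ) ^ 2 := by gcongr
    nlinarith)
  refine ⟨G, h1, h2, ?_⟩
  have h5 : Real.log r ^ ((5 : ℝ) / 2) = x ^ 5 := by
    rw [hx, Real.sqrt_eq_rpow, ← Real.rpow_natCast, ← Real.rpow_mul (by linarith)]
    norm_num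
  calc (#G.edges : ℝ) ≤ 64 * (12 * r * s) ^ 5 := by exact_mod_cast h3
    _ ≤ 64 * (12 * r * (43 * x)) ^ 5 := by gcongr
    _ = _ := by rw [h5]; ring

end LooseTriangle

/-- There is a constant `C > 0` such that `m_{C_3}(r) ≤ C·r^5·(ln r)^(5/2)`
for all `r ≥ 2`: some `C_3`-free 3-graph with chromatic number `> r` has at most that many
edges. -/
theorem mH_looseC3_upper :
    ∃ C : ℝ, 0 < C ∧ ∀ r : ℕ, 2 ≤ r →
      ∃ G : ThreeGraph, G.Free looseC3 ∧ ¬ G.Colorable r ∧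
        (G.edges.card : ℝ) ≤ C * (r : ℝ) ^ 5 * Real.log r ^ ((5 : ℝ) / 2) := by
  obtain ⟨r₀, h⟩ := LooseTriangle.exists_threeGraph_of_large
  obtain ⟨G₀, hfree, hcol, -⟩ := h r₀ le_rfl
  have hlog2 : 0 < Real.log 2 := Real.log_pos one_lt_two
  set m : ℝ := 2 ^ 5 * Real.log 2 ^ ((5 : ℝ) / 2) with hm
  have hmpos : 0 < m := by positivity
  refine ⟨64 * 516 ^ 5 + G₀.edges.card / m, by positivity, fun r hr => ?_⟩
  have hr2 : (2 : ℝ) ≤ r := by exact_mod_cast hr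
  have hlog : Real.log 2 ≤ Real.log r := Real.log_le_log two_pos hr2
  have hmr : m ≤ (r : ℝ) ^ 5 * Real.log r ^ ((5 : ℝ) / 2) := by
    rw [hm]
    gcongr
  rcases le_total r₀ r with hle | hle
  · obtain ⟨G, h1, h2, h3⟩ := h r hle
    refine ⟨G, h1, h2, h3.trans ?_⟩
    gcongr
    exact le_add_of_nonneg_right (by positivity)
  · refine ⟨G₀, hfree, fun hc => hcol (hc.mono hle), ?_⟩
    rw [mul_assoc]
    calc (G₀.edges.card : ℝ) = G₀.edges.card / m * m := by field_simp
      _ ≤ (64 * 516 ^ 5 + G₀.edges.card / m) * ((r : ℝ) ^ 5 * Real.log r ^ ((5 : ℝ) / 2)) := by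
        gcongr
        linarith
end

section
/- For every ε > 0 there exists a constant c > 0 such that for all integers r ≥ 2 one has m_{K_4^-}(r) ≥ c·r^3·(ln r)^{1−ε}. -/
/-- `K_4^-`: the 3-graph on 4 vertices with the three edges
`{1,2,3}, {1,2,4}, {1,3,4}` (here written 0-indexed). -/
def K4minus : ThreeGraph where
  n := 4
  edges := {({0, 1, 2} : Finset (Fin 4)), {0, 1, 3}, {0, 2, 3}}
  card_eq := by decide

namespace ThreeGraph

section Finsets

variable {V : Type*} [DecidableEq V] {E : Finset (Finset V)}

/-- One vertex set `S` is independent, `A` is a set of candidates forming no edge with a pair of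
`S`, and the links of the vertices of `D ⊆ S` are empty on `A`. If `A` is large then `S` can be
traded for an independent set of size `t`. -/
theorem exists_indep_of_candidates
    (hE : ∀ e ∈ E, e.card = 3)
    (hfree : ∀ a b c d : V, ({a, b, c} : Finset V) ∈ E → ({a, b, d} : Finset V) ∈ E →
      ({a, c, d} : Finset V) ∉ E) {U : Finset V} {t : ℕ} (k : ℕ) :
    ∀ S D A : Finset V, S ⊆ U → A ⊆ U → D ⊆ S → Disjoint S A →
      (∀ e ∈ E, ¬ e ⊆ S) →
      (∀ s ∈ S, ∀ s' ∈ S, ∀ a ∈ A, ({s, s', a} : Finset V) ∉ E) →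
      (∀ s ∈ D, ∀ a ∈ A, ∀ b ∈ A, ({s, a, b} : Finset V) ∉ E) →
      (2 * t) ^ k ≤ A.card → 2 * t ≤ k + S.card + D.card →
      ∃ I ⊆ U, (∀ e ∈ E, ¬ e ⊆ I) ∧ t ≤ I.card := by
  induction k with
  | zero =>
    intro S D A hSU _ hDS _ hS _ _ _ hcard
    have := Finset.card_le_card hDS
    exact ⟨S, hSU, hS, by omega⟩
  | succ k ih =>
    intro S D A hSU hAU hDS hdisj hS hSS hD hA hcard
    by_cases hSt : t ≤ S.card
    · exact ⟨S, hSU, hS, hSt⟩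
    push Not at hSt
    have hpow : 1 ≤ (2 * t) ^ k := Nat.one_le_pow _ _ (by omega)
    rw [pow_succ] at hA
    by_cases hkill : ∃ s ∈ S, s ∉ D ∧ ∃ x ∈ A,
        A.card ≤ 2 * t * (A.filter fun y => ({s, x, y} : Finset V) ∈ E).card
    · obtain ⟨s, hs, hsD, x, hx, hbig⟩ := hkill
      refine ih S (insert s D) (A.filter fun y => ({s, x, y} : Finset V) ∈ E) hSU
        ((Finset.filter_subset _ _).trans hAU) (Finset.insert_subset hs hDS)
        (hdisj.mono_right (Finset.filter_subset _ _)) hS ?_ ?_ ?_ ?_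
      · intro u hu v hv a ha
        exact hSS u hu v hv a (Finset.mem_filter.1 ha).1
      · intro u hu a ha b hb
        rw [Finset.mem_filter] at ha hb
        rcases Finset.mem_insert.1 hu with rfl | hu
        · exact hfree u x a b ha.2 hb.2
        · exact hD u hu a ha.1 b hb.1
      · have : (2 * t) * (2 * t) ^ k ≤
            2 * t * (A.filter fun y => ({s, x, y} : Finset V) ∈ E).card := by
          rw [mul_comm]; exact hA.trans hbig
        exact Nat.le_of_mul_le_mul_left this (by omega)
      · rw [Finset.card_insert_of_notMem hsD]; omega
    · push Not at hkill
      have hApos : 0 < A.card := by nlinarith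
      obtain ⟨x, hx⟩ := Finset.card_pos.1 hApos
      have hxS : x ∉ S := fun h => Finset.disjoint_left.1 hdisj h hx
      set B : Finset V := S.biUnion fun s => A.filter fun y => ({s, x, y} : Finset V) ∈ E
      have hBcard : 2 * t * B.card ≤ S.card * A.card := by
        calc 2 * t * B.card
            ≤ 2 * t * ∑ s ∈ S, (A.filter fun y => ({s, x, y} : Finset V) ∈ E).card :=
              Nat.mul_le_mul_left _ Finset.card_biUnion_le
          _ = ∑ s ∈ S, 2 * t * (A.filter fun y => ({s, x, y} : Finset V) ∈ E).card :=
              Finset.mul_sum _ _ _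
          _ ≤ ∑ _s ∈ S, A.card := by
              refine Finset.sum_le_sum fun s hs => ?_
              by_cases hsD : s ∈ D
              · rw [Finset.filter_false_of_mem fun y hy => hD s hsD x hx y hy]
                simp
              · exact (hkill s hs hsD x hx).le
          _ = S.card * A.card := by simp
      have hsub : insert x S ⊆ U := Finset.insert_subset (hAU hx) hSU
      refine ih (insert x S) D ((A \ B).erase x) hsub
        ((Finset.erase_subset _ _).trans (Finset.sdiff_subset.trans hAU))
        (hDS.trans (Finset.subset_insert _ _)) ?_ ?_ ?_ ?_ ?_ ?_
      · rw [Finset.disjoint_left]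
        intro y hy hy'
        rw [Finset.mem_erase, Finset.mem_sdiff] at hy'
        rcases Finset.mem_insert.1 hy with rfl | hy
        · exact hy'.1 rfl
        · exact Finset.disjoint_left.1 hdisj hy hy'.2.1
      · intro e he hsubs
        by_cases hxe : x ∈ e
        · have h2 : (e.erase x).card = 2 := by
            rw [Finset.card_erase_of_mem hxe, hE e he]
          obtain ⟨u, v, -, huv⟩ := Finset.card_eq_two.1 h2
          have hmem : ∀ y ∈ e.erase x, y ∈ S := fun y hy =>
            (Finset.mem_insert.1 (hsubs (Finset.mem_of_mem_erase hy))).resolve_left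
              (Finset.ne_of_mem_erase hy)
          refine hSS u (hmem u (by simp [huv])) v (hmem v (by simp [huv])) x hx ?_
          have : ({u, v, x} : Finset V) = e := by
            rw [← Finset.insert_erase hxe, huv]
            ext y; simp only [Finset.mem_insert, Finset.mem_singleton]; tauto
          rwa [this]
        · exact hS e he ((Finset.subset_insert_iff_of_notMem hxe).1 hsubs)
      · have key : ∀ s ∈ insert x S, ∀ a ∈ (A \ B).erase x, ({s, x, a} : Finset V) ∉ E := by
          intro s hs a ha h
          rw [Finset.mem_erase, Finset.mem_sdiff] at ha
          rcases Finset.mem_insert.1 hs with rfl | hs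
          · have h3 := hE _ h
            have : ({s, s, a} : Finset V).card ≤ 2 := by
              rw [Finset.insert_eq_of_mem (by simp)]; exact Finset.card_le_two
            omega
          · exact ha.2.2 (Finset.mem_biUnion.2 ⟨s, hs, Finset.mem_filter.2 ⟨ha.2.1, h⟩⟩)
        intro s hs s' hs' a ha h
        rcases Finset.mem_insert.1 hs' with rfl | hs'S
        · exact key s hs a ha h
        rcases Finset.mem_insert.1 hs with rfl | hsS
        · rw [Finset.insert_comm] at h
          exact key s' hs' a ha h
        · exact hSS s hsS s' hs'S a
            (Finset.mem_sdiff.1 (Finset.mem_of_mem_erase ha)).1 h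
      · intro s hs a ha b hb
        exact hD s hs a (Finset.mem_sdiff.1 (Finset.mem_of_mem_erase ha)).1 b
          (Finset.mem_sdiff.1 (Finset.mem_of_mem_erase hb)).1
      · have h1 : A.card ≤ ((A \ B).erase x).card + 1 + B.card := by
          have := Finset.le_card_sdiff B A
          have := Finset.pred_card_le_card_erase (s := A \ B) (a := x)
          omega
        have h2 : S.card * A.card ≤ (t - 1) * A.card := Nat.mul_le_mul_right _ (by omega)
        obtain ⟨u, rfl⟩ : ∃ u, t = u + 1 := ⟨t - 1, by omega⟩
        simp only [Nat.add_sub_cancel] at h2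
        have h3 : 2 * (u + 1) * A.card ≤
            2 * (u + 1) * (((A \ B).erase x).card + 1 + B.card) := Nat.mul_le_mul_left _ h1
        have h4 : 2 * (u + 1) * (2 * (u + 1)) ^ k ≤
            2 * (u + 1) * ((A \ B).erase x).card := by nlinarith
        exact Nat.le_of_mul_le_mul_left h4 (by omega)
      · rw [Finset.card_insert_of_notMem hxS]; omega

theorem exists_indep_of_pow_le_card
    (hE : ∀ e ∈ E, e.card = 3)
    (hfree : ∀ a b c d : V, ({a, b, c} : Finset V) ∈ E → ({a, b, d} : Finset V) ∈ E →
      ({a, c, d} : Finset V) ∉ E) {U : Finset V} {t : ℕ} (hU : (2 * t) ^ (2 * t) ≤ U.card) :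
    ∃ I ⊆ U, (∀ e ∈ E, ¬ e ⊆ I) ∧ t ≤ I.card := by
  refine exists_indep_of_candidates hE hfree (2 * t) ∅ ∅ U (by simp) subset_rfl subset_rfl
    (by simp) ?_ (by simp) (by simp) hU (by simp)
  intro e he h
  have := hE e he
  rw [Finset.subset_empty.1 h] at this
  simp at this

/-- Colouring by repeatedly extracting independent sets of size `t`. -/
theorem exists_coloring_of_card_le
    (hE : ∀ e ∈ E, e.card = 3)
    (hfree : ∀ a b c d : V, ({a, b, c} : Finset V) ∈ E → ({a, b, d} : Finset V) ∈ E →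
      ({a, c, d} : Finset V) ∉ E) {t q : ℕ} (hq : (2 * t) ^ (2 * t) ≤ q) (j : ℕ) :
    ∀ U : Finset V, U.card ≤ q + j * t →
      ∃ c : V → ℕ, (∀ v ∈ U, c v < q + j) ∧
        ∀ e ∈ E, e ⊆ U → ∃ u ∈ e, ∃ v ∈ e, c u ≠ c v := by
  have small : ∀ U : Finset V, U.card ≤ q →
      ∃ c : V → ℕ, (∀ v ∈ U, c v < q) ∧
        ∀ e ∈ E, e ⊆ U → ∃ u ∈ e, ∃ v ∈ e, c u ≠ c v := by
    intro U hU
    let c : V → ℕ := fun v => if h : v ∈ U then (U.equivFin ⟨v, h⟩ : ℕ) else 0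
    refine ⟨c, ?_, ?_⟩
    · intro v hv
      simp only [c, hv, dif_pos]
      exact (Fin.is_lt _).trans_le hU
    · intro e he hsub
      obtain ⟨u, hu, v, hv, huv⟩ := Finset.one_lt_card.1 (by rw [hE e he]; norm_num : 1 < e.card)
      refine ⟨u, hu, v, hv, fun h => huv ?_⟩
      simp only [c, hsub hu, hsub hv, dif_pos] at h
      simpa using U.equivFin.injective (Fin.ext h)
  induction j with
  | zero => intro U hU; simpa using small U (by simpa using hU)
  | succ j ih =>
    intro U hU
    by_cases hUq : U.card ≤ q
    · obtain ⟨c, hc, hc'⟩ := small U hUq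
      exact ⟨c, fun v hv => (hc v hv).trans_le (by omega), hc'⟩
    · obtain ⟨I, hIU, hI, hIt⟩ := exists_indep_of_pow_le_card hE hfree
        (U := U) (t := t) (by omega)
      obtain ⟨c, hc, hc'⟩ := ih (U \ I) (by
        rw [Finset.card_sdiff_of_subset hIU]
        rw [add_mul] at hU
        omega)
      refine ⟨fun v => if v ∈ I then q + j else c v, ?_, ?_⟩
      · intro v hv
        by_cases hvI : v ∈ I
        · simp only [hvI, if_true]; omega
        · simp only [hvI, if_false]
          have := hc v (Finset.mem_sdiff.2 ⟨hv, hvI⟩)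
          omega
      · intro e he hsub
        obtain ⟨v, hv, hvI⟩ := Finset.not_subset.1 (hI e he)
        by_cases hdis : ∃ u ∈ e, u ∈ I
        · obtain ⟨u, hu, huI⟩ := hdis
          refine ⟨u, hu, v, hv, ?_⟩
          simp only [huI, hvI, if_true, if_false]
          exact (hc v (Finset.mem_sdiff.2 ⟨hsub hv, hvI⟩)).ne'
        · push Not at hdis
          obtain ⟨u, hu, w, hw, huw⟩ := hc' e he fun y hy =>
            Finset.mem_sdiff.2 ⟨hsub hy, hdis y hy⟩
          exact ⟨u, hu, w, hw, by simpa [hdis u hu, hdis w hw] using huw⟩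

/-- At most a fraction `1 / k ^ 2` of all `k`-colourings is constant on a given triple. -/
theorem card_monochromatic_mul_sq_le_s6 [Fintype V] {e : Finset V} (he : e.card = 3) (k : ℕ) :
    (Finset.univ.filter fun c : V → Fin k => ∀ u ∈ e, ∀ v ∈ e, c u = c v).card * k ^ 2 ≤
      Fintype.card (V → Fin k) := by
  obtain ⟨a, b, d, hab, had, hbd, rfl⟩ := Finset.card_eq_three.1 he
  set M := Finset.univ.filter fun c : V → Fin k =>
    ∀ u ∈ ({a, b, d} : Finset V), ∀ v ∈ ({a, b, d} : Finset V), c u = c v with hM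
  have hcard : M.card * k ^ 2 = (M ×ˢ (Finset.univ : Finset (Fin k × Fin k))).card := by
    simp [Finset.card_product, sq]
  rw [hcard, ← Finset.card_univ]
  refine Finset.card_le_card_of_injOn
    (fun p => Function.update (Function.update p.1 b p.2.1) d p.2.2) (by simp) ?_
  rintro ⟨c, i, j⟩ hc ⟨c', i', j'⟩ hc' h
  simp only [hM, Finset.coe_product, Set.mem_prod, Finset.mem_coe, Finset.mem_filter,
    Finset.mem_univ, true_and, and_true] at hc hc'
  have hv := fun v => congrFun h v
  have hi : i = i' := by simpa [hbd] using hv b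
  have hj : j = j' := by simpa using hv d
  have ha : c a = c' a := by simpa [hab, had] using hv a
  have hcc : c = c' := by
    funext v
    by_cases hvb : v = b
    · subst hvb
      rw [hc v (by simp) a (by simp), hc' v (by simp) a (by simp), ha]
    by_cases hvd : v = d
    · subst hvd
      rw [hc v (by simp) a (by simp), hc' v (by simp) a (by simp), ha]
    · simpa [hvb, hvd] using hv v
  simp [hi, hj, hcc]

theorem exists_coloring_few_monochromatic [Fintype V] (hE : ∀ e ∈ E, e.card = 3)
    {k : ℕ} (hk : 0 < k) :
    ∃ c : V → Fin k,
      (E.filter fun e => ∀ u ∈ e, ∀ v ∈ e, c u = c v).card * k ^ 2 ≤ E.card := by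
  by_contra! hcon
  have : NeZero k := ⟨hk.ne'⟩
  have h1 : ∑ _c : V → Fin k, E.card <
      ∑ c : V → Fin k, (E.filter fun e => ∀ u ∈ e, ∀ v ∈ e, c u = c v).card * k ^ 2 :=
    Finset.sum_lt_sum_of_nonempty Finset.univ_nonempty fun c _ => hcon c
  have h2 : ∑ c : V → Fin k, (E.filter fun e => ∀ u ∈ e, ∀ v ∈ e, c u = c v).card * k ^ 2 =
      ∑ e ∈ E, (Finset.univ.filter fun c : V → Fin k =>
        ∀ u ∈ e, ∀ v ∈ e, c u = c v).card * k ^ 2 := by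
    rw [← Finset.sum_mul, ← Finset.sum_mul]
    congr 1
    simp only [Finset.card_filter]
    exact Finset.sum_comm
  have h3 := Finset.sum_le_sum fun e he => card_monochromatic_mul_sq_le_s6 (hE e he) k
  rw [h2] at h1
  simp only [Finset.sum_const, smul_eq_mul, Finset.card_univ] at h1 h3
  rw [mul_comm] at h1
  omega

end Finsets

theorem Free.notMem_edges {G : ThreeGraph} (hG : G.Free K4minus) (a b c d : Fin G.n)
    (habc : ({a, b, c} : Finset (Fin G.n)) ∈ G.edges)
    (habd : ({a, b, d} : Finset (Fin G.n)) ∈ G.edges) :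
    ({a, c, d} : Finset (Fin G.n)) ∉ G.edges := by
  intro hacd
  have distinct : ∀ x y z : Fin G.n, ({x, y, z} : Finset (Fin G.n)) ∈ G.edges →
      x ≠ y ∧ x ≠ z ∧ y ≠ z := by
    intro x y z h
    have h3 := G.card_eq _ h
    refine ⟨?_, ?_, ?_⟩ <;> rintro rfl
    · have : ({x, x, z} : Finset (Fin G.n)).card ≤ 2 := by
        rw [Finset.insert_eq_of_mem (by simp)]; exact Finset.card_le_two
      omega
    · have : ({x, y, x} : Finset (Fin G.n)).card ≤ 2 := by
        rw [Finset.insert_eq_of_mem (by simp)]; exact Finset.card_le_two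
      omega
    · have : ({x, y, y} : Finset (Fin G.n)).card ≤ 2 := by
        simpa using Finset.card_le_two (a := x) (b := y)
      omega
  obtain ⟨hab, hac, hbc⟩ := distinct a b c habc
  obtain ⟨-, had, hbd⟩ := distinct a b d habd
  obtain ⟨-, -, hcd⟩ := distinct a c d hacd
  let f : Fin 4 → Fin G.n := ![a, b, c, d]
  have hf : Function.Injective f := by
    intro i j h
    fin_cases i <;> fin_cases j <;> simp_all [f]
  have himage : ∀ e ∈ ({{0, 1, 2}, {0, 1, 3}, {0, 2, 3}} : Finset (Finset (Fin 4))),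
      e.image f ∈ G.edges := by
    intro e he
    simp only [Finset.mem_insert, Finset.mem_singleton] at he
    rcases he with rfl | rfl | rfl
    · simpa [Finset.image_insert, f] using habc
    · simpa [Finset.image_insert, f] using habd
    · simpa [Finset.image_insert, f] using hacd
  exact hG ⟨⟨f, hf⟩, himage⟩

theorem edges_nonempty_of_not_colorable {G : ThreeGraph} {r : ℕ} (hr : 0 < r)
    (hG : ¬ G.Colorable r) : G.edges.Nonempty := by
  by_contra h
  rw [Finset.not_nonempty_iff_eq_empty] at h
  exact hG ⟨fun _ => ⟨0, hr⟩, by simp [h]⟩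

/-- A `k`-colouring with few monochromatic edges, corrected with `2 * h` further colours. -/
theorem Free.mul_le_card_edges {G : ThreeGraph} (hG : G.Free K4minus) {r k h t : ℕ}
    (hr : k + 2 * h ≤ r) (hk : 0 < k) (hcol : ¬ G.Colorable r)
    (ht : (2 * t) ^ (2 * t) ≤ h) : h * t * k ^ 2 ≤ G.edges.card := by
  obtain ⟨c, hc⟩ := exists_coloring_few_monochromatic G.card_eq hk
  obtain ⟨M, hM, hMcard⟩ : ∃ M : Finset (Finset (Fin G.n)),
      (∀ e, e ∈ M ↔ e ∈ G.edges ∧ ∀ u ∈ e, ∀ v ∈ e, c u = c v) ∧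
        M.card * k ^ 2 ≤ G.edges.card :=
    ⟨_, by simp, hc⟩
  refine le_trans (Nat.mul_le_mul_right _ ?_) hMcard
  by_contra! hlt
  have hne : ∀ e ∈ M, ∃ v, v ∈ e := fun e he =>
    Finset.card_pos.1 (by rw [G.card_eq e ((hM e).1 he).1]; norm_num)
  obtain ⟨e₀, he₀⟩ := edges_nonempty_of_not_colorable (by omega) hcol
  obtain ⟨v₀, -⟩ := Finset.card_pos.1 (by rw [G.card_eq e₀ he₀]; norm_num : 0 < e₀.card)
  have : Nonempty (Fin G.n) := ⟨v₀⟩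
  choose! p hp using hne
  set S := M.image p
  obtain ⟨c', hc'lt, hc'⟩ := exists_coloring_of_card_le G.card_eq hG.notMem_edges ht h S
    ((Finset.card_image_le).trans (by omega))
  refine hcol ⟨fun v => if hv : v ∈ S then ⟨k + c' v, by have := hc'lt v hv; omega⟩
    else ⟨c v, by have := (c v).2; omega⟩, ?_⟩
  intro e he
  by_contra! hmono
  by_cases hS : ∃ u ∈ e, u ∈ S
  · obtain ⟨u, hu, huS⟩ := hS
    have hsub : e ⊆ S := by
      intro v hv
      by_contra hvS
      have := congrArg Fin.val (hmono u hu v hv)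
      simp only [huS, hvS, dif_pos, dif_neg, not_false_eq_true] at this
      have := (c v).2
      omega
    obtain ⟨v, hv, w, hw, hvw⟩ := hc' e he hsub
    have := congrArg Fin.val (hmono v hv w hw)
    simp only [hsub hv, hsub hw, dif_pos] at this
    omega
  · push Not at hS
    have heM : e ∈ M := by
      refine (hM e).2 ⟨he, fun u hu v hv => Fin.ext ?_⟩
      simpa only [hS u hu, hS v hv, dif_neg, not_false_eq_true] using
        congrArg Fin.val (hmono u hu v hv)
    exact hS _ (hp e heM) (Finset.mem_image_of_mem p heM)

end ThreeGraph

open Filter Asymptotics in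
/-- A number `t` of order `(log r) ^ (1 - ε)` satisfies `(2t)^(2t) ≤ r / 4` for large `r`. -/
theorem eventually_exists_pow_self_le {ε : ℝ} (hε : 0 < ε) :
    ∀ᶠ r : ℕ in atTop, ∃ t : ℕ, (2 * t) ^ (2 * t) ≤ r / 4 ∧
      Real.log r ^ (1 - ε) ≤ 2 * t := by
  have hlog : Tendsto (fun r : ℕ => Real.log r) atTop atTop :=
    Real.tendsto_log_atTop.comp tendsto_natCast_atTop_atTop
  set δ : ℝ := min ε (1 / 2)
  have hδ : 0 < δ := lt_min hε (by norm_num)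
  have hδ1 : δ ≤ 1 / 2 := min_le_right _ _
  have hδε : δ ≤ ε := min_le_left _ _
  have h1 := hlog.eventually ((isLittleO_log_rpow_atTop hδ).bound (by norm_num : (0 : ℝ) < 1 / 8))
  filter_upwards [h1, hlog.eventually_ge_atTop 2, eventually_ge_atTop 64] with r hr hL hr64
  set L := Real.log r with hLdef
  have hL0 : 0 < L := by linarith
  have hLa1 : 1 ≤ L ^ (1 - δ) := Real.one_le_rpow (by linarith) (by linarith)
  have hLaL : L ^ (1 - δ) ≤ L := by
    simpa using Real.rpow_le_rpow_of_exponent_le (by linarith : 1 ≤ L)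
      (by linarith : 1 - δ ≤ 1)
  have hlogL : 0 ≤ Real.log L := Real.log_nonneg (by linarith)
  rw [Real.norm_of_nonneg hlogL, Real.norm_of_nonneg (by positivity)] at hr
  set t := ⌊L ^ (1 - δ)⌋₊
  have ht1 : 1 ≤ t := Nat.le_floor (by simpa using hLa1)
  have htle : (t : ℝ) ≤ L ^ (1 - δ) := Nat.floor_le (by positivity)
  have htlt : L ^ (1 - δ) < t + 1 := Nat.lt_floor_add_one _
  have ht1' : (1 : ℝ) ≤ t := by exact_mod_cast ht1
  have hmul : L ^ (1 - δ) * L ^ δ = L := by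
    rw [← Real.rpow_add hL0]; simp
  refine ⟨t, ?_, ?_⟩
  · have hlog2t : Real.log (2 * t) ≤ 2 * Real.log L := by
      calc Real.log (2 * t) ≤ Real.log (L ^ 2) :=
            Real.log_le_log (by positivity) (by nlinarith)
        _ = 2 * Real.log L := by simp
    have hexp : 2 * t * Real.log (2 * t) ≤ L / 2 := by
      calc 2 * t * Real.log (2 * t) ≤ 2 * t * (2 * Real.log L) := by gcongr
        _ ≤ 2 * L ^ (1 - δ) * (2 * (1 / 8 * L ^ δ)) := by gcongr
        _ = (L ^ (1 - δ) * L ^ δ) / 2 := by ring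
        _ = L / 2 := by rw [hmul]
    have hrR : (64 : ℝ) ≤ r := by exact_mod_cast hr64
    have hsq : Real.exp (L / 2) ≤ r / 8 := by
      have hsq' : Real.exp (L / 2) ^ 2 = r := by
        rw [← Real.exp_nat_mul, hLdef]
        rw [show ((2 : ℕ) : ℝ) * (Real.log r / 2) = Real.log r by push_cast; ring]
        exact Real.exp_log (by linarith)
      have := Real.exp_pos (L / 2)
      nlinarith [sq_nonneg (Real.exp (L / 2) - 8)]
    have hpow : ((2 * t : ℝ)) ^ (2 * t) ≤ r / 8 := by
      refine le_trans (le_of_eq ?_) ((Real.exp_le_exp.2 hexp).trans hsq)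
      rw [show (2 * t * Real.log (2 * t) : ℝ) = ((2 * t : ℕ) : ℝ) * Real.log (2 * t) by
        push_cast; ring, Real.exp_nat_mul, Real.exp_log (by positivity)]
    have hpow' : 8 * (2 * t) ^ (2 * t) ≤ r := by
      have : 8 * ((2 * t : ℝ)) ^ (2 * t) ≤ r := by linarith
      exact_mod_cast this
    omega
  · calc L ^ (1 - ε) ≤ L ^ (1 - δ) :=
          Real.rpow_le_rpow_of_exponent_le (by linarith) (by linarith)
      _ ≤ 2 * t := by linarith

/-- For every `ε > 0` there is a constant `c > 0` such that
`m_{K_4^-}(r) ≥ c·r^3·(ln r)^(1−ε)` for all `r ≥ 2`. -/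
theorem mH_K4minus_lower :
    ∀ ε : ℝ, 0 < ε → ∃ c : ℝ, 0 < c ∧
      ∀ r : ℕ, 2 ≤ r → ∀ G : ThreeGraph, G.Free K4minus → ¬ G.Colorable r →
        c * (r : ℝ) ^ 3 * Real.log r ^ ((1 : ℝ) - ε) ≤ (G.edges.card : ℝ) := by
  intro ε hε
  obtain ⟨R, hR⟩ := Filter.eventually_atTop.1 (eventually_exists_pow_self_le hε)
  obtain ⟨B, hB⟩ := ((Finset.range (max R 8)).image
    fun r : ℕ => (r : ℝ) ^ 3 * Real.log r ^ ((1 : ℝ) - ε)).bddAbove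
  have hB1 : 0 < max B 1 := lt_max_of_lt_right one_pos
  refine ⟨min (1 / 1024) (1 / max B 1), by positivity, ?_⟩
  intro r hr G hG hcol
  have hlog : 0 ≤ Real.log r ^ ((1 : ℝ) - ε) :=
    Real.rpow_nonneg (Real.log_natCast_nonneg r) _
  rw [mul_assoc]
  by_cases hrR : r < max R 8
  · have hBr : (r : ℝ) ^ 3 * Real.log r ^ ((1 : ℝ) - ε) ≤ max B 1 :=
      (hB (Finset.mem_coe.2 (Finset.mem_image_of_mem _ (Finset.mem_range.2 hrR)))).trans
        (le_max_left _ _)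
    have hcard : (1 : ℝ) ≤ G.edges.card := by
      exact_mod_cast Finset.card_pos.2
        (ThreeGraph.edges_nonempty_of_not_colorable (by omega) hcol)
    calc _ ≤ 1 / max B 1 * max B 1 := by gcongr; exact min_le_right _ _
      _ = 1 := by field_simp
      _ ≤ _ := hcard
  · push Not at hrR
    obtain ⟨t, ht, htlog⟩ := hR r ((le_max_left _ _).trans hrR)
    have hr8 : 8 ≤ r := (le_max_right _ _).trans hrR
    have hmain := hG.mul_le_card_edges (r := r) (k := r / 2) (by omega) (by omega) hcol ht
    have hmainR : ((r / 4 : ℕ) : ℝ) * t * ((r / 2 : ℕ) : ℝ) ^ 2 ≤ G.edges.card := by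
      exact_mod_cast hmain
    have h4 : (r : ℝ) / 8 ≤ ((r / 4 : ℕ) : ℝ) := by
      have : r ≤ 8 * (r / 4) := by omega
      have : (r : ℝ) ≤ 8 * ((r / 4 : ℕ) : ℝ) := by exact_mod_cast this
      linarith
    have h2 : (r : ℝ) / 8 ≤ ((r / 2 : ℕ) : ℝ) := by
      have : r ≤ 8 * (r / 2) := by omega
      have : (r : ℝ) ≤ 8 * ((r / 2 : ℕ) : ℝ) := by exact_mod_cast this
      linarith
    calc _ ≤ 1 / 1024 * ((r : ℝ) ^ 3 * (2 * t)) := by gcongr; exact min_le_left _ _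
      _ = (r : ℝ) / 8 * t * ((r : ℝ) / 8) ^ 2 := by ring
      _ ≤ ((r / 4 : ℕ) : ℝ) * t * ((r / 2 : ℕ) : ℝ) ^ 2 := by gcongr
      _ ≤ _ := hmainR
end
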